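/- arXiv:2008.08263 — 3 statements merged into one kernel-verified Lean document; each statement's English description precedes it below -/
import Mathlib

section
/- Let Ω ⊂ ℝⁿ be a bounded open set, f ∈ L^∞(Ω), and let u be a weak solution of ∇·A∇u = f in Ω with A-gradient G = ∇_A u such that the truncation pair (u₊, 1_{u>0} G) belongs to (W_A^{1,2})₀(Ω). Suppose there exist a constant P > 0 and a nonnegative measurable function v on Ω with ‖f‖_{L^∞(Ω)} ≤ P v(x) for almost every x ∈ {u > 0} ∩ Ω. Then ∫_Ω |1_{u>0} G|² dμ ≤ P ∫_Ω u₊ v dμ, where u₊ = max{u,0} and dμ = dx/|Ω|. -/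
open MeasureTheory Filter Topology Set Matrix ENNReal NNReal

noncomputable section

/-- Vectors in `ℝⁿ`. -/
abbrev Vec (n : ℕ) := Fin n → ℝ

/-- The (pointwise) gradient of a real valued function on `ℝⁿ`, via `fderiv`
(junk value `0` at points of non-differentiability). -/
noncomputable def grad {n : ℕ} (w : Vec n → ℝ) (x : Vec n) : Vec n :=
  fun i => fderiv ℝ w x (Pi.single i 1)

/-- The `A`-gradient `∇_A w = B ∇w`, where `A = BᵀB`. -/
noncomputable def Agrad {n : ℕ} (Bm : Vec n → Matrix (Fin n) (Fin n) ℝ)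
    (w : Vec n → ℝ) (x : Vec n) : Vec n :=
  (Bm x) *ᵥ (grad w x)

/-- Lipschitz function with compact support contained in `Ω`. -/
def IsLipCpt {n : ℕ} (Ω : Set (Vec n)) (w : Vec n → ℝ) : Prop :=
  (∃ L, LipschitzWith L w) ∧ HasCompactSupport w ∧ tsupport w ⊆ Ω

/-- Squared euclidean norm of a vector in `ℝⁿ`. -/
noncomputable def sqNorm {n : ℕ} (v : Vec n) : ℝ := ∑ i, (v i) ^ 2

/-- Squared `L²(Ω)` distance of two scalar functions. -/
noncomputable def l2dist {n : ℕ} (Ω : Set (Vec n)) (f g : Vec n → ℝ) : ℝ≥0∞ :=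
  ∫⁻ x in Ω, ENNReal.ofReal ((f x - g x) ^ 2)

/-- Squared `L²(Ω;ℝⁿ)` distance of two vector valued functions. -/
noncomputable def l2distV {n : ℕ} (Ω : Set (Vec n)) (F G : Vec n → Vec n) : ℝ≥0∞ :=
  ∫⁻ x in Ω, ENNReal.ofReal (sqNorm (fun i => F x i - G x i))

/-- The pair `(u, G)` belongs to the degenerate Sobolev space `(W_A^{1,2})₀(Ω)`:
`u ∈ L²(Ω)`, `G ∈ L²(Ω;ℝⁿ)` and there are compactly supported Lipschitz functions `w k`
with `w k → u` in `L²(Ω)` and `B ∇(w k) → G` in `L²(Ω;ℝⁿ)`. -/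
def MemW12zero {n : ℕ} (Ω : Set (Vec n)) (Bm : Vec n → Matrix (Fin n) (Fin n) ℝ)
    (u : Vec n → ℝ) (G : Vec n → Vec n) : Prop :=
  AEMeasurable u (volume.restrict Ω) ∧ AEMeasurable G (volume.restrict Ω) ∧
  (∫⁻ x in Ω, ENNReal.ofReal ((u x) ^ 2)) < ⊤ ∧
  (∫⁻ x in Ω, ENNReal.ofReal (sqNorm (G x))) < ⊤ ∧
  ∃ w : ℕ → Vec n → ℝ,
    (∀ k, IsLipCpt Ω (w k)) ∧
    Tendsto (fun k => l2dist Ω (w k) u) atTop (𝓝 0) ∧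
    Tendsto (fun k => l2distV Ω (fun x => Agrad Bm (w k) x) G) atTop (𝓝 0)

/-- `u` (with `A`-gradient `G`) is a weak solution of `∇·A∇u = f` in `Ω`. -/
def IsWeakSol {n : ℕ} (Ω : Set (Vec n)) (Bm : Vec n → Matrix (Fin n) (Fin n) ℝ)
    (f u : Vec n → ℝ) (G : Vec n → Vec n) : Prop :=
  MemW12zero Ω Bm u G ∧
  ∀ φ : Vec n → ℝ, IsLipCpt Ω φ →
    (∫ x in Ω, ∑ i, G x i * Agrad Bm φ x i) = - ∫ x in Ω, f x * φ x

/-- `B` is a bounded Lipschitz matrix valued function. -/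
def BoundedLipMatrix {n : ℕ} (Bm : Vec n → Matrix (Fin n) (Fin n) ℝ) : Prop :=
  (∃ M : ℝ, ∀ x i j, |Bm x i j| ≤ M) ∧
  (∃ L : NNReal, ∀ i j, LipschitzWith L (fun x => Bm x i j))

/-- The normalized measure `dμ = dx/|Ω|` on `Ω`. -/
noncomputable def normMeasure {n : ℕ} (Ω : Set (Vec n)) : Measure (Vec n) :=
  (volume Ω)⁻¹ • volume.restrict Ω

/-- The convex conjugate (Legendre transform) `θ̃(t) = sup_s (st − θ(s))` of a
`[0,∞]`-valued function, computed with truncated subtraction in `[0,∞]`. -/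
noncomputable def youngConj (θ : ℝ → ℝ≥0∞) (t : ℝ) : ℝ≥0∞ :=
  ⨆ s : ℝ, ENNReal.ofReal (s * t) - θ s

/-- `θ : ℝ → [0,∞]` is a Young function. -/
structure IsYoung (θ : ℝ → ℝ≥0∞) : Prop where
  convex : ∀ x y a b : ℝ, 0 ≤ a → 0 ≤ b → a + b = 1 →
    θ (a * x + b * y) ≤ ENNReal.ofReal a * θ x + ENNReal.ofReal b * θ y
  lsc : LowerSemicontinuous θ
  even : ∀ t, θ (-t) = θ t
  zero : θ 0 = 0
  nontrivial : ∃ t > 0, θ t ≠ 0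
  conj_nontrivial : ∃ t > 0, youngConj θ t ≠ 0

/-- The Luxemburg norm `‖f‖_{L^θ(μ)} = inf {k > 0 : ∫ θ(f/k) dμ ≤ 1}`, with `inf ∅ = ∞`. -/
noncomputable def luxNorm {α : Type*} [MeasurableSpace α] (θ : ℝ → ℝ≥0∞)
    (μ : Measure α) (f : α → ℝ) : ℝ≥0∞ :=
  sInf (ENNReal.ofReal '' {k : ℝ | 0 < k ∧ ∫⁻ x, θ (f x / k) ∂μ ≤ 1})

/-- The Orlicz bump function `Φ_N`: `Φ_N(t) = t (ln t)^N` for `t ≥ e^{2N}` and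
`Φ_N(t) = (2N)^N t` for `0 ≤ t ≤ e^{2N}`, extended evenly. -/
noncomputable def orliczBump (N : ℝ) (t : ℝ) : ℝ≥0∞ :=
  if |t| ≤ Real.exp (2 * N) then ENNReal.ofReal ((2 * N) ^ N * |t|)
  else ENNReal.ofReal (|t| * Real.log |t| ^ N)

end

theorem aux_enorm_sq (a : ℝ) : ENNReal.ofReal (a ^ 2) = ‖a‖ₑ ^ (2:ℝ) := by
  rw [← sq_abs, ENNReal.ofReal_pow (abs_nonneg a), ← Real.enorm_eq_ofReal_abs]
  norm_cast

theorem aux_memLp {α : Type*} [MeasurableSpace α] {μ : Measure α} {h : α → ℝ}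
    (hm : AEMeasurable h μ) (h2 : ∫⁻ x, ENNReal.ofReal ((h x) ^ 2) ∂μ < ⊤) : MemLp h 2 μ := by
  refine ⟨hm.aestronglyMeasurable, ?_⟩
  rw [eLpNorm_lt_top_iff_lintegral_rpow_enorm_lt_top (by norm_num) (by norm_num)]
  simpa [aux_enorm_sq] using h2

theorem aux_conv {α : Type*} [MeasurableSpace α] {μ : Measure α} {h g : α → ℝ} {w : ℕ → α → ℝ}
    (hm : AEMeasurable h μ) (h2 : ∫⁻ x, ENNReal.ofReal ((h x) ^ 2) ∂μ < ⊤)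
    (gm : AEMeasurable g μ) (g2 : ∫⁻ x, ENNReal.ofReal ((g x) ^ 2) ∂μ < ⊤)
    (wm : ∀ k, AEMeasurable (w k) μ)
    (hw : Tendsto (fun k => ∫⁻ x, ENNReal.ofReal ((w k x - g x) ^ 2) ∂μ) atTop (𝓝 0)) :
    (∀ᶠ k in atTop, Integrable (fun x => h x * w k x) μ) ∧ Integrable (fun x => h x * g x) μ ∧
    Tendsto (fun k => ∫ x, h x * w k x ∂μ) atTop (𝓝 (∫ x, h x * g x ∂μ)) := by
  have hL := aux_memLp hm h2
  have gL := aux_memLp gm g2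
  have hI : Integrable (fun x => h x * g x) μ := hL.integrable_mul gL
  have hE : ∀ᶠ k in atTop, Integrable (fun x => h x * w k x) μ := by
    have : ∀ᶠ k in atTop, ∫⁻ x, ENNReal.ofReal ((w k x - g x) ^ 2) ∂μ < ⊤ :=
      hw.eventually (gt_mem_nhds (by simp))
    filter_upwards [this] with k hk
    have h1 : MemLp (fun x => w k x - g x) 2 μ := aux_memLp ((wm k).sub gm) hk
    have h3 : Integrable (fun x => h x * (w k x - g x)) μ := hL.integrable_mul h1
    refine (h3.add hI).congr (Eventually.of_forall fun x => ?_)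
    simp only [Pi.add_apply]; ring
  refine ⟨hE, hI, tendsto_integral_of_L1 _ hI.aestronglyMeasurable hE ?_⟩
  have key : ∀ k, ∫⁻ x, ‖h x * w k x - h x * g x‖ₑ ∂μ ≤
      (∫⁻ x, ENNReal.ofReal ((h x) ^ 2) ∂μ) ^ (1/(2:ℝ)) *
      (∫⁻ x, ENNReal.ofReal ((w k x - g x) ^ 2) ∂μ) ^ (1/(2:ℝ)) := by
    intro k
    have := ENNReal.lintegral_mul_le_Lp_mul_Lq μ (p := 2) (q := 2) Real.HolderConjugate.two_two
      hm.enorm ((wm k).sub gm).enorm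
    simp only [aux_enorm_sq]
    simpa [← mul_sub, enorm_mul] using this
  have lim : Tendsto (fun k => (∫⁻ x, ENNReal.ofReal ((h x) ^ 2) ∂μ) ^ (1/(2:ℝ)) *
      (∫⁻ x, ENNReal.ofReal ((w k x - g x) ^ 2) ∂μ) ^ (1/(2:ℝ))) atTop (𝓝 0) := by
    have h1 := (ENNReal.continuous_rpow_const (y := 1/(2:ℝ))).tendsto 0 |>.comp hw
    have h3 := ENNReal.Tendsto.const_mul (a := (∫⁻ x, ENNReal.ofReal ((h x) ^ 2) ∂μ) ^ (1/(2:ℝ)))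
      h1 (Or.inr (ENNReal.rpow_ne_top_of_nonneg (by norm_num) h2.ne))
    simpa using h3
  exact tendsto_of_tendsto_of_tendsto_of_le_of_le tendsto_const_nhds lim (fun _ => zero_le) key

theorem aux_comp_le {n : ℕ} (v : Vec n) (i : Fin n) : (v i) ^ 2 ≤ sqNorm v :=
  Finset.single_le_sum (f := fun i => (v i) ^ 2) (fun _ _ => sq_nonneg _) (Finset.mem_univ i)

theorem aux_Agrad {n : ℕ} {Bm : Vec n → Matrix (Fin n) (Fin n) ℝ} (hBm : BoundedLipMatrix Bm)
    (w : Vec n → ℝ) (i : Fin n) : Measurable (fun x => Agrad Bm w x i) := by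
  obtain ⟨-, L, hL⟩ := hBm
  simp only [Agrad, Matrix.mulVec, dotProduct, grad]
  refine Finset.measurable_sum _ fun j _ => ?_
  exact (hL i j).continuous.measurable.mul (measurable_fderiv_apply_const ℝ w _)

/-- If `u` is a weak solution of `∇·A∇u = f` in `Ω` with `f ∈ L^∞(Ω)` and
`∇_A u = G`, the truncation pair `(u₊, 1_{u>0} G)` belongs to `(W_A^{1,2})₀(Ω)`, and
`‖f‖_{L^∞(Ω)} ≤ P v(x)` a.e. on `{u > 0} ∩ Ω` for some `P > 0` and nonnegative measurable
`v`, then `∫_Ω |1_{u>0} G|² dμ ≤ P ∫_Ω u₊ v dμ`, where `dμ = dx/|Ω|`. -/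
theorem statement7 {n : ℕ} (Ω : Set (Vec n)) (hΩo : IsOpen Ω) (hΩb : Bornology.IsBounded Ω)
    (Bm : Vec n → Matrix (Fin n) (Fin n) ℝ) (hBm : BoundedLipMatrix Bm)
    (f : Vec n → ℝ) (hfm : AEMeasurable f (volume.restrict Ω))
    (hf : eLpNorm f ⊤ (volume.restrict Ω) < ⊤)
    (u : Vec n → ℝ) (G : Vec n → Vec n)
    (hu : IsWeakSol Ω Bm f u G)
    (htr : MemW12zero Ω Bm (fun x => max (u x) 0) (Set.indicator {x | 0 < u x} G))
    (P : ℝ) (hP : 0 < P)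
    (v : Vec n → ℝ) (hvm : AEMeasurable v (volume.restrict Ω)) (hvnn : ∀ x, 0 ≤ v x)
    (hfv : ∀ᵐ x ∂(volume.restrict Ω), 0 < u x →
      eLpNorm f ⊤ (volume.restrict Ω) ≤ ENNReal.ofReal (P * v x)) :
    (∫⁻ x, ENNReal.ofReal (sqNorm (Set.indicator {x | 0 < u x} G x)) ∂(normMeasure Ω)) ≤
      ENNReal.ofReal P * ∫⁻ x, ENNReal.ofReal (max (u x) 0 * v x) ∂(normMeasure Ω) := by
  obtain ⟨⟨hum, hGm, hu2, hG2, -⟩, hweak⟩ := hu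
  obtain ⟨hpm, hHm, hp2, hH2, w, hwL, hw1, hw2⟩ := htr
  set H := Set.indicator {x | 0 < u x} G with hH
  set μ := volume.restrict Ω with hμ
  have hfin : IsFiniteMeasure μ := ⟨by
    rw [hμ, Measure.restrict_apply_univ]; exact hΩb.measure_lt_top⟩
  -- bound on f
  set K := (eLpNorm f ⊤ μ).toReal with hK
  have hfK : ∀ᵐ x ∂μ, |f x| ≤ K := by
    have := ae_le_eLpNormEssSup (f := f) (μ := μ)
    filter_upwards [this] with x hx
    rw [← eLpNorm_exponent_top] at hx
    have := ENNReal.toReal_mono hf.ne hx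
    simpa [hK] using this
  have hf2 : ∫⁻ x, ENNReal.ofReal ((f x) ^ 2) ∂μ < ⊤ := by
    calc ∫⁻ x, ENNReal.ofReal ((f x) ^ 2) ∂μ ≤ ∫⁻ x, ENNReal.ofReal (K ^ 2) ∂μ := by
          apply lintegral_mono_ae
          filter_upwards [hfK] with x hx
          exact ENNReal.ofReal_le_ofReal (sq_le_sq' (abs_le.1 hx).1 (abs_le.1 hx).2)
      _ < ⊤ := by
          rw [lintegral_const]
          exact ENNReal.mul_lt_top ENNReal.ofReal_lt_top (measure_lt_top _ _)
  obtain ⟨-, hfuI, hlim1⟩ := aux_conv (w := w) hfm hf2 hpm hp2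
    (fun k => (hwL k).1.choose_spec.continuous.aemeasurable) hw1
  have hcomp : ∀ i, (∀ᶠ k in atTop, Integrable (fun x => G x i * Agrad Bm (w k) x i) μ) ∧
      Integrable (fun x => G x i * H x i) μ ∧
      Tendsto (fun k => ∫ x, G x i * Agrad Bm (w k) x i ∂μ) atTop
        (𝓝 (∫ x, G x i * H x i ∂μ)) := by
    intro i
    refine aux_conv (w := fun k x => Agrad Bm (w k) x i) (aemeasurable_pi_iff.1 hGm i) ?_
      (aemeasurable_pi_iff.1 hHm i) ?_ (fun k => (aux_Agrad hBm (w k) i).aemeasurable) ?_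
    · exact (lintegral_mono fun x => ENNReal.ofReal_le_ofReal (aux_comp_le (G x) i)).trans_lt hG2
    · exact (lintegral_mono fun x => ENNReal.ofReal_le_ofReal (aux_comp_le (H x) i)).trans_lt hH2
    · refine tendsto_of_tendsto_of_tendsto_of_le_of_le tendsto_const_nhds hw2
        (fun _ => zero_le) (fun k => ?_)
      exact lintegral_mono fun x => ENNReal.ofReal_le_ofReal
        (aux_comp_le (fun i => Agrad Bm (w k) x i - H x i) i)
  have hlim2 : Tendsto (fun k => ∫ x, ∑ i, G x i * Agrad Bm (w k) x i ∂μ) atTop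
      (𝓝 (∑ i, ∫ x, G x i * H x i ∂μ)) := by
    refine (tendsto_finsetSum Finset.univ fun i _ => (hcomp i).2.2).congr' ?_
    have : ∀ᶠ k in atTop, ∀ i, Integrable (fun x => G x i * Agrad Bm (w k) x i) μ :=
      eventually_all.2 fun i => (hcomp i).1
    filter_upwards [this] with k hk
    exact (integral_finsetSum _ fun i _ => hk i).symm
  have hlim3 : Tendsto (fun k => ∫ x, ∑ i, G x i * Agrad Bm (w k) x i ∂μ) atTop
      (𝓝 (-∫ x, f x * max (u x) 0 ∂μ)) :=
    hlim1.neg.congr fun k => (hweak (w k) (hwL k)).symm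
  have heq := tendsto_nhds_unique hlim2 hlim3
  rw [← integral_finsetSum _ fun i _ => (hcomp i).2.1] at heq
  have hGH : ∀ x, ∑ i, G x i * H x i = sqNorm (H x) := by
    intro x
    unfold sqNorm
    refine Finset.sum_congr rfl fun i _ => ?_
    by_cases hx : 0 < u x
    · have : H x = G x := Set.indicator_of_mem (s := {x | 0 < u x}) hx G
      rw [this]; ring
    · have : H x = 0 := Set.indicator_of_notMem (s := {x | 0 < u x}) hx G
      rw [this]; simp
  have hI : Integrable (fun x => sqNorm (H x)) μ :=
    (integrable_finsetSum Finset.univ fun i _ => (hcomp i).2.1).congr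
      (Eventually.of_forall hGH)
  simp only [hGH] at heq
  have main : (∫⁻ x, ENNReal.ofReal (sqNorm (H x)) ∂μ) ≤
      ENNReal.ofReal P * ∫⁻ x, ENNReal.ofReal (max (u x) 0 * v x) ∂μ := by
    rw [← ofReal_integral_eq_lintegral_ofReal hI
      (Eventually.of_forall fun x => Finset.sum_nonneg fun i _ => sq_nonneg _), heq,
      ← integral_neg, ← lintegral_const_mul' _ _ ENNReal.ofReal_ne_top]
    refine (ENNReal.ofReal_le_ofReal (integral_mono_ae hfuI.neg hfuI.norm
      (Eventually.of_forall fun x => neg_le_abs _))).trans ?_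
    rw [ofReal_integral_eq_lintegral_ofReal hfuI.norm
      (Eventually.of_forall fun x => norm_nonneg _)]
    apply lintegral_mono_ae
    filter_upwards [hfK, hfv] with x hx hv
    rw [← ENNReal.ofReal_mul hP.le]
    apply ENNReal.ofReal_le_ofReal
    rw [norm_mul, Real.norm_eq_abs, Real.norm_of_nonneg (le_max_right _ _)]
    by_cases h0 : 0 < u x
    · have h1 : K ≤ P * v x := ENNReal.toReal_le_of_le_ofReal (mul_nonneg hP.le (hvnn x)) (hv h0)
      have h2 : 0 ≤ max (u x) 0 := le_max_right _ _
      calc |f x| * max (u x) 0 ≤ (P * v x) * max (u x) 0 :=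
            mul_le_mul_of_nonneg_right (hx.trans h1) h2
        _ = P * (max (u x) 0 * v x) := by ring
    · rw [max_eq_right (not_lt.1 h0)]; simp
  simp only [normMeasure, lintegral_smul_measure, smul_eq_mul]
  calc _ ≤ (volume Ω)⁻¹ * (ENNReal.ofReal P * ∫⁻ x, ENNReal.ofReal (max (u x) 0 * v x) ∂μ) :=
        mul_le_mul_right main _
    _ = _ := by ring
end

section
/- Let 0 < α < 1/2, let B = B(0,1/2) ⊂ ℝ² be the Euclidean ball of radius 1/2 centered at the origin, and define u(x) = (ln(1/|x|))^α for 0 < |x| < 1/2 and f(x) = α(α−1)|x|^{−2}(ln(1/|x|))^{α−2} for 0 < |x| < 1/2. Then: (i) u ∈ L²(B) and its pointwise gradient ∇u (defined for x ≠ 0) satisfies ∫_B |∇u|² dx < ∞; (ii) f ∈ L¹(B); (iii) u is a weak solution of Δu = f on B, i.e. ∫_B ∇u·∇φ dx = −∫_B f φ dx for every smooth φ with compact support in B; and (iv) u is essentially unbounded on every neighborhood of the origin. In particular, the Dirichlet problem for the Laplacian can have an unbounded weak solution with right-hand side in L¹. -/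
open MeasureTheory Filter Topology Set ENNReal RealInnerProductSpace

noncomputable section

/-- The plane `ℝ²` as a Euclidean space. -/
abbrev E2 := EuclideanSpace ℝ (Fin 2)

lemma aux_log_pos {r : ℝ} (h0 : 0 < r) (h1 : r < 1) : 0 < Real.log (1 / r) :=
  Real.log_pos (by rw [lt_div_iff₀ h0]; linarith)

lemma aux_hasDeriv (b : ℝ) {r : ℝ} (h0 : 0 < r) (h1 : r < 1) :
    HasDerivAt (fun s : ℝ => Real.log (1 / s) ^ b) (-(b * Real.log (1 / r) ^ (b - 1) * r⁻¹)) r := by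
  have hL := aux_log_pos h0 h1
  have h2 : HasDerivAt (fun s : ℝ => Real.log (1 / s)) (-r⁻¹) r := by
    have := (Real.hasDerivAt_log h0.ne').neg
    refine this.congr_of_eventuallyEq (Eventually.of_forall fun s => ?_)
    simp
  have := h2.rpow_const (p := b) (Or.inl hL.ne')
  convert this using 1
  ring

lemma aux_tendsto_log : Tendsto (fun s : ℝ => Real.log (1 / s)) (𝓝[>] 0) atTop := by
  simp only [one_div]
  exact Real.tendsto_log_atTop.comp tendsto_inv_nhdsGT_zero

lemma aux_cont {b : ℝ} (hb : b < 0) :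
    ContinuousOn (fun s : ℝ => Real.log (1 / s) ^ b) (Icc 0 (1 / 2)) := by
  intro r hr
  rcases hr.1.eq_or_lt with h | h
  · subst h
    have h1 : ContinuousWithinAt (fun s : ℝ => Real.log (1 / s) ^ b) (Ioi 0) 0 := by
      rw [ContinuousWithinAt]
      have : Real.log (1 / (0 : ℝ)) ^ b = 0 := by simp [Real.zero_rpow hb.ne]
      rw [this]
      have h2 := tendsto_rpow_neg_atTop (y := -b) (by linarith)
      rw [neg_neg] at h2
      exact h2.comp aux_tendsto_log
    exact (continuousWithinAt_Ioi_iff_Ici.1 h1).mono Icc_subset_Ici_self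
  · exact (aux_hasDeriv b h (by linarith [hr.2])).continuousAt.continuousWithinAt

lemma aux_int1 {b : ℝ} (hb : b < -1) :
    IntegrableOn (fun r : ℝ => Real.log (1 / r) ^ b * r⁻¹) (Ioo 0 (1 / 2)) := by
  have h := intervalIntegral.integrableOn_deriv_of_nonneg (a := 0) (b := 1 / 2)
    (g := fun s : ℝ => Real.log (1 / s) ^ (b + 1))
    (g' := fun r => -((b + 1) * Real.log (1 / r) ^ (b + 1 - 1) * r⁻¹))
    (aux_cont (by linarith)) (fun x hx => aux_hasDeriv _ hx.1 (by linarith [hx.2]))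
    (fun x hx => by
      have := aux_log_pos hx.1 (by linarith [hx.2])
      have h3 := Real.rpow_pos_of_pos this (b + 1 - 1)
      have h4 := inv_pos.2 hx.1
      have : 0 < -(b + 1) := by linarith
      have := mul_pos (mul_pos this h3) h4
      linarith)
  have h := (h.mono_set Ioo_subset_Ioc_self).const_mul (-(b + 1))⁻¹
  refine IntegrableOn.congr_fun h (fun x hx => ?_) measurableSet_Ioo
  have : -(b + 1) ≠ 0 := by linarith
  simp only [add_sub_cancel_right]
  field_simp
  have : b + 1 ≠ 0 := by linarith
  field_simp

lemma aux_radial {g : ℝ → ℝ} (h : IntegrableOn (fun r => r * g r) (Ioo 0 (1 / 2))) :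
    IntegrableOn (fun x : E2 => g ‖x‖) (Metric.ball 0 (1 / 2)) := by
  rw [integrableOn_fun_norm_addHaar]
  simpa using h

lemma aux_int2 {b : ℝ} (hb : b < -1) :
    IntegrableOn (fun x : E2 => Real.log (1 / ‖x‖) ^ b * (‖x‖ ^ 2)⁻¹) (Metric.ball 0 (1 / 2)) := by
  apply aux_radial (g := fun r => Real.log (1 / r) ^ b * (r ^ 2)⁻¹)
  refine (aux_int1 hb).congr_fun (fun x hx => ?_) measurableSet_Ioo
  have := hx.1.ne'
  simp only
  field_simp

lemma aux_int3 : IntegrableOn (fun x : E2 => ‖x‖⁻¹) (Metric.ball 0 (1 / 2)) := by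
  apply aux_radial (g := fun r => r⁻¹)
  have : IntegrableOn (fun _ : ℝ => (1 : ℝ)) (Ioo 0 (1 / 2)) := by simp
  refine this.congr_fun (fun x hx => ?_) measurableSet_Ioo
  have := hx.1.ne'
  simp only
  field_simp

lemma aux_ae {P : E2 → Prop} (h : ∀ x : E2, x ≠ 0 → ‖x‖ < 1 / 2 → P x) :
    ∀ᵐ x ∂(volume.restrict (Metric.ball (0 : E2) (1 / 2))), P x := by
  have h1 : ∀ᵐ x ∂(volume.restrict (Metric.ball (0 : E2) (1 / 2))), x ≠ 0 :=
    ae_restrict_of_ae (by simp [ae_iff])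
  filter_upwards [h1, ae_restrict_mem measurableSet_ball] with x hx hx2
  exact h x hx (by simpa using hx2)

lemma aux_grad (α : ℝ) {x : E2} (h0 : x ≠ 0) (h1 : ‖x‖ < 1 / 2) :
    HasGradientAt (fun x : E2 => Real.log (1 / ‖x‖) ^ α)
      (-(α * Real.log (1 / ‖x‖) ^ (α - 1) * (‖x‖ ^ 2)⁻¹) • x) x := by
  have hn : 0 < ‖x‖ := norm_pos_iff.2 h0
  have hL := aux_log_pos hn (by linarith)
  have h2 : HasFDerivAt (fun y : E2 => Real.log (1 / ‖y‖))
      ((-(1 / 2) : ℝ) • ((‖x‖ ^ 2)⁻¹ • ((2 : ℝ) • (innerSL ℝ x)))) x := by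
    have h3 := ((hasFDerivAt_id x).norm_sq.log (by simpa using h0)).const_mul (-(1 / 2) : ℝ)
    have h4 : HasFDerivAt (fun y : E2 => Real.log (1 / ‖y‖)) _ x :=
      h3.congr_of_eventuallyEq (Eventually.of_forall fun s => by simp)
    refine h4.congr_fderiv ?_
    ext y
    simp
  have h5 := h2.rpow_const (p := α) (Or.inl hL.ne')
  rw [hasGradientAt_iff_hasFDerivAt]
  refine h5.congr_fderiv (ContinuousLinearMap.ext fun y => ?_)
  simp only [InnerProductSpace.toDual_apply_apply, inner_smul_left, smul_apply,
    innerSL_apply_apply, smul_eq_mul, conj_trivial]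
  ring

lemma aux_polar (H : E2 → ℝ)
    (h : ∀ θ : E2, ‖θ‖ = 1 → ∫ r in Ioi (0 : ℝ), r * H (r • θ) = 0) : ∫ x, H x = 0 := by
  have e1 : ∫ x, H x = ∫ x : ({(0 : E2)}ᶜ : Set E2), H x.1 ∂((volume : Measure E2).comap (↑)) := by
    rw [integral_subtype_comap (measurableSet_singleton _).compl fun x ↦ H x,
        restrict_compl_singleton]
  have e2 : ∫ x : ({(0 : E2)}ᶜ : Set E2), H x.1 ∂((volume : Measure E2).comap (↑)) =
      ∫ p, H (p.2.1 • p.1.1) ∂((volume : Measure E2).toSphere.prod (.volumeIoiPow 1)) := by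
    have := (volume : Measure E2).measurePreserving_homeomorphUnitSphereProd.integral_comp
        (Homeomorph.measurableEmbedding _) (fun p => H (p.2.1 • p.1.1))
    have hd : Module.finrank ℝ E2 - 1 = 1 := by simp
    rw [hd] at this
    rw [← this]
    congr 1
    ext x
    congr 1
    have hx : ‖x.1‖ ≠ 0 := norm_ne_zero_iff.2 x.2
    simp [smul_smul, hx]
  rw [e1, e2]
  by_cases hi : Integrable (fun p : (Metric.sphere (0 : E2) 1) × (Ioi (0 : ℝ)) => H (p.2.1 • p.1.1))
      ((volume : Measure E2).toSphere.prod (.volumeIoiPow 1))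
  · rw [integral_prod _ hi]
    refine integral_eq_zero_of_ae (Eventually.of_forall fun θ => ?_)
    simp only [Measure.volumeIoiPow, ENNReal.ofReal, Pi.zero_apply]
    rw [integral_withDensity_eq_integral_smul,
      integral_subtype_comap measurableSet_Ioi
        fun a : ℝ ↦ Real.toNNReal (a ^ 1) • H (a • θ.1)]
    · refine Eq.trans (setIntegral_congr_fun measurableSet_Ioi fun x hx ↦ ?_) (h θ.1 (by simp))
      show Real.toNNReal (x ^ 1) • H (x • θ.1) = x * H (x • θ.1)
      rw [NNReal.smul_def, Real.coe_toNNReal _ (pow_nonneg (le_of_lt hx) _)]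
      simp
    · exact (measurable_subtype_coe.pow_const _).real_toNNReal
  · exact integral_undef hi

lemma aux_ray (α : ℝ) (hα : α < 1 / 2) (φ : E2 → ℝ) (hφ : ContDiff ℝ (⊤ : ℕ∞) φ)
    (hs : tsupport φ ⊆ Metric.ball (0 : E2) (1 / 2)) (θ : E2) (hθ : ‖θ‖ = 1) :
    ∫ r in Ioo (0 : ℝ) (1 / 2), (α * -((α - 1) * Real.log (1 / r) ^ (α - 1 - 1) * r⁻¹) * φ (r • θ)
      + α * Real.log (1 / r) ^ (α - 1) * ⟪gradient φ (r • θ), θ⟫) = 0 := by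
  rw [← integral_Ioc_eq_integral_Ioo,
    ← intervalIntegral.integral_of_le (by norm_num : (0 : ℝ) ≤ 1 / 2)]
  by_cases hi : IntervalIntegrable (fun r : ℝ =>
      (α * -((α - 1) * Real.log (1 / r) ^ (α - 1 - 1) * r⁻¹) * φ (r • θ)
      + α * Real.log (1 / r) ^ (α - 1) * ⟪gradient φ (r • θ), θ⟫)) volume 0 (1 / 2)
  · rw [intervalIntegral.integral_eq_sub_of_hasDerivAt_of_le
      (f := fun r : ℝ => α * Real.log (1 / r) ^ (α - 1) * φ (r • θ)) (by norm_num) ?_ ?_ hi]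
    · have h1 : φ ((1 / 2 : ℝ) • θ) = 0 := by
        apply image_eq_zero_of_notMem_tsupport
        intro h
        have := hs h
        simp [norm_smul, hθ] at this
      have h2 : α - 1 ≠ 0 := by linarith
      rw [h1]
      simp [Real.zero_rpow h2]
    · have hc : Continuous φ := hφ.continuous
      exact ((aux_cont (by linarith)).const_mul α).mul (by fun_prop)
    · intro r hr
      have h1 := (aux_hasDeriv (α - 1) hr.1 (by linarith [hr.2])).const_mul α
      refine h1.mul ?_
      have hd : HasFDerivAt φ (InnerProductSpace.toDual ℝ E2 (gradient φ (r • θ))) (r • θ) :=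
        (hφ.differentiable (by simp) _).hasGradientAt.hasFDerivAt
      have h2 : HasDerivAt (fun r : ℝ => r • θ) θ r := by
        simpa using (hasDerivAt_id r).smul_const θ
      have h3 := hd.comp_hasDerivAt r h2
      rw [InnerProductSpace.toDual_apply_apply] at h3
      exact h3
  · exact intervalIntegral.integral_undef hi

lemma aux_unbdd (α : ℝ) (hα0 : 0 < α) (u : E2 → ℝ)
    (hu : ∀ x : E2, u x = Real.log (1 / ‖x‖) ^ α) (U : Set E2) (hU : U ∈ 𝓝 (0 : E2)) :
    eLpNorm u ⊤ (volume.restrict U) = ⊤ := by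
  by_contra hne
  rw [eLpNorm_exponent_top] at hne
  set C := eLpNormEssSup u (volume.restrict U) with hC
  have h1 : ∀ᵐ y ∂(volume.restrict U), ‖u y‖ₑ ≤ C := ae_le_eLpNormEssSup
  have ht : Tendsto u (𝓝[≠] 0) atTop := by
    have : u = (fun t : ℝ => t ^ α) ∘ (fun s : ℝ => Real.log (1 / s)) ∘ (fun x : E2 => ‖x‖) := by
      ext x; simp [hu]
    rw [this]
    exact (tendsto_rpow_atTop hα0).comp (aux_tendsto_log.comp tendsto_norm_nhdsNE_zero)
  have h2 : ∀ᶠ x in 𝓝[≠] (0 : E2), C.toReal < u x := ht.eventually_gt_atTop _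
  rw [eventually_nhdsWithin_iff] at h2
  obtain ⟨V, hVsub, hVo, hV0⟩ := mem_nhds_iff.1 (inter_mem h2 hU)
  have hpos : 0 < volume V := hVo.measure_pos volume ⟨0, hV0⟩
  have h3 : ∀ᵐ y ∂(volume.restrict V), ‖u y‖ₑ ≤ C :=
    ae_restrict_of_ae_restrict_of_subset (fun y hy => (hVsub hy).2) h1
  have h4 : ∀ᵐ y ∂(volume.restrict V), y ≠ (0 : E2) := ae_restrict_of_ae (by simp [ae_iff])
  have h5 : ∀ᵐ y ∂(volume.restrict V), False := by
    filter_upwards [h3, h4, ae_restrict_mem hVo.measurableSet] with y hy hy0 hyV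
    have h6 : C.toReal < u y := (hVsub hyV).1 hy0
    have h7 := ENNReal.toReal_mono hne hy
    simp only [toReal_enorm, Real.norm_eq_abs] at h7
    linarith [le_abs_self (u y)]
  simp [ae_iff] at h5
  exact hpos.ne' h5

theorem statement13 (α : ℝ) (hα0 : 0 < α) (hα : α < 1 / 2)
    (u f : E2 → ℝ)
    (hu : ∀ x : E2, u x = Real.log (1 / ‖x‖) ^ α)
    (hf : ∀ x : E2, f x = α * (α - 1) * ‖x‖ ^ (-2 : ℝ) * Real.log (1 / ‖x‖) ^ (α - 2)) :
    (letI B : Set E2 := Metric.ball 0 (1 / 2)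
    -- (i) `u ∈ L²(B)` and its pointwise gradient is square integrable on `B`
    (∫⁻ x in B, ENNReal.ofReal ((u x) ^ 2)) < ⊤ ∧
    (∫⁻ x in B, ENNReal.ofReal (‖gradient u x‖ ^ 2)) < ⊤ ∧
    -- (ii) `f ∈ L¹(B)`
    IntegrableOn f B ∧
    -- (iii) `u` is a weak solution of `Δu = f` on `B`
    (∀ φ : E2 → ℝ, ContDiff ℝ (⊤ : ℕ∞) φ → HasCompactSupport φ → tsupport φ ⊆ B →
      (∫ x in B, ⟪gradient u x, gradient φ x⟫) = - ∫ x in B, f x * φ x) ∧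
    -- (iv) `u` is essentially unbounded on every neighborhood of the origin
    (∀ U ∈ 𝓝 (0 : E2), eLpNorm u ⊤ (volume.restrict U) = ⊤)) := by
  have hgrad : ∀ x : E2, x ≠ 0 → ‖x‖ < 1 / 2 →
      gradient u x = -(α * Real.log (1 / ‖x‖) ^ (α - 1) * (‖x‖ ^ 2)⁻¹) • x := by
    intro x h0 h1
    have : u = fun x : E2 => Real.log (1 / ‖x‖) ^ α := funext hu
    rw [this]
    exact (aux_grad α h0 h1).gradient
  have hnorm : ∀ x : E2, x ≠ 0 → ‖x‖ < 1 / 2 →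
      ‖gradient u x‖ = α * Real.log (1 / ‖x‖) ^ (α - 1) * ‖x‖⁻¹ := by
    intro x h0 h1
    have hn : 0 < ‖x‖ := norm_pos_iff.2 h0
    have hL := Real.rpow_pos_of_pos (aux_log_pos hn (by linarith)) (α - 1)
    rw [hgrad x h0 h1, norm_smul, Real.norm_eq_abs, abs_neg, abs_of_pos (by positivity)]
    field_simp
  have hfint : IntegrableOn f (Metric.ball 0 (1 / 2)) := by
    have := (aux_int2 (b := α - 2) (by linarith)).const_mul (α * (α - 1))
    refine IntegrableOn.congr_fun this (fun x _ => ?_) measurableSet_ball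
    simp only [hf]
    rw [Real.rpow_neg (norm_nonneg _)]
    norm_cast
    ring
  refine ⟨?_, ?_, hfint, ?_, fun U hU => aux_unbdd α hα0 u hu U hU⟩
  · refine lt_of_le_of_lt (lintegral_mono_ae (aux_ae ?_)) aux_int3.lintegral_lt_top
    intro x h0 h1
    have hn : 0 < ‖x‖ := norm_pos_iff.2 h0
    have hL := aux_log_pos hn (by linarith)
    apply ENNReal.ofReal_le_ofReal
    rw [hu, ← Real.rpow_natCast, ← Real.rpow_mul hL.le]
    have h3 : Real.log (1 / ‖x‖) ≤ 1 / ‖x‖ - 1 := Real.log_le_sub_one_of_pos (by positivity)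
    rw [one_div] at *
    have hone : 1 ≤ ‖x‖⁻¹ := by linarith
    calc Real.log ‖x‖⁻¹ ^ (α * (2 : ℕ)) ≤ ‖x‖⁻¹ ^ (α * (2 : ℕ)) := by
          apply Real.rpow_le_rpow hL.le (by linarith)
          positivity
      _ ≤ ‖x‖⁻¹ ^ (1 : ℝ) := by
          apply Real.rpow_le_rpow_of_exponent_le hone
          push_cast; linarith
      _ = _ := Real.rpow_one _
  · have := (aux_int2 (b := 2 * α - 2) (by linarith)).const_mul (α ^ 2)
    refine lt_of_le_of_lt (lintegral_mono_ae (aux_ae ?_)) this.lintegral_lt_top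
    intro x h0 h1
    have hn : 0 < ‖x‖ := norm_pos_iff.2 h0
    have hL := aux_log_pos hn (by linarith)
    apply ENNReal.ofReal_le_ofReal
    rw [hnorm x h0 h1, mul_pow, mul_pow, ← Real.rpow_natCast (Real.log _ ^ _),
      ← Real.rpow_mul hL.le]
    have : (α - 1) * (2 : ℕ) = 2 * α - 2 := by push_cast; ring
    rw [this]
    apply le_of_eq
    rw [inv_pow]; ring
  · intro φ hφ hc hs
    have hgc : Continuous (gradient φ) := by
      have := hφ.continuous_fderiv (by simp)
      exact (InnerProductSpace.toDual ℝ E2).symm.continuous.comp this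
    have hcb : ∃ K : ℝ, ∀ x ∈ Metric.closedBall (0 : E2) (1 / 2), ‖gradient φ x‖ ≤ K :=
      (isCompact_closedBall _ _).exists_bound_of_continuousOn hgc.continuousOn
    obtain ⟨K, hK⟩ := hcb
    obtain ⟨K', hK'⟩ := (isCompact_closedBall (0 : E2) (1 / 2)).exists_bound_of_continuousOn
      hφ.continuous.continuousOn
    have hI2 : IntegrableOn (fun x => f x * φ x) (Metric.ball 0 (1 / 2)) := by
      refine Integrable.mul_bdd (c := K') hfint hφ.continuous.aestronglyMeasurable ?_
      filter_upwards [ae_restrict_mem measurableSet_ball] with x hx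
      exact hK' x (Metric.ball_subset_closedBall hx)
    have hI1 : IntegrableOn (fun x => ⟪gradient u x, gradient φ x⟫) (Metric.ball 0 (1 / 2)) := by
      refine Integrable.mono' (aux_int3.const_mul (α * Real.log 2 ^ (α - 1) * K)) ?_ (aux_ae ?_)
      · have hm : Measurable fun x : E2 =>
            ⟪-(α * Real.log (1 / ‖x‖) ^ (α - 1) * (‖x‖ ^ 2)⁻¹) • x, gradient φ x⟫ := by
          have := hgc.measurable
          fun_prop
        refine hm.aestronglyMeasurable.congr (aux_ae ?_)
        intro x h0 h1
        simp only
        rw [hgrad x h0 h1]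
      · intro x h0 h1
        have hn : 0 < ‖x‖ := norm_pos_iff.2 h0
        have hKx : ‖gradient φ x‖ ≤ K := hK x (by simpa using h1.le)
        refine (norm_inner_le_norm _ _).trans ?_
        rw [hnorm x h0 h1]
        have h2 : Real.log (1 / ‖x‖) ^ (α - 1) ≤ Real.log 2 ^ (α - 1) := by
          apply Real.rpow_le_rpow_of_nonpos (Real.log_pos (by norm_num)) _ (by linarith)
          apply Real.log_le_log (by norm_num)
          rw [le_div_iff₀ hn]; linarith
        have h3 : 0 ≤ Real.log 2 ^ (α - 1) := Real.rpow_nonneg (Real.log_nonneg (by norm_num)) _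
        calc α * Real.log (1 / ‖x‖) ^ (α - 1) * ‖x‖⁻¹ * ‖gradient φ x‖
            ≤ α * Real.log 2 ^ (α - 1) * ‖x‖⁻¹ * K := by gcongr
          _ = _ := by ring
    rw [eq_neg_iff_add_eq_zero, ← integral_add hI1 hI2, ← integral_indicator measurableSet_ball]
    apply aux_polar
    intro θ hθ
    have hray := congrArg Neg.neg (aux_ray α hα φ hφ hs θ hθ)
    rw [neg_zero] at hray
    refine Eq.trans ?_ hray
    rw [← integral_neg, ← integral_indicator measurableSet_Ioi, ← integral_indicator measurableSet_Ioo]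
    congr 1
    ext r
    by_cases h0 : 0 < r
    · by_cases h1 : r < 1 / 2
      · have hn : ‖r • θ‖ = r := by simp [norm_smul, hθ, abs_of_pos h0]
        have hne : r • θ ≠ 0 := by rw [← norm_pos_iff, hn]; exact h0
        rw [indicator_of_mem (show r ∈ Ioi 0 from h0), indicator_of_mem (by simpa [hn] using h1),
          indicator_of_mem (show r ∈ Ioo 0 (1 / 2) from ⟨h0, h1⟩),
          hgrad _ hne (by rw [hn]; exact h1), hf, hn, inner_smul_left, inner_smul_left,
          real_inner_comm θ, Real.rpow_neg h0.le]
        have : α - 1 - 1 = α - 2 := by ring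
        rw [this]
        norm_cast
        simp only [conj_trivial]
        field_simp
        ring
      · have hn : ‖r • θ‖ = r := by simp [norm_smul, hθ, abs_of_pos h0]
        rw [indicator_of_mem (show r ∈ Ioi 0 from h0), indicator_of_notMem (by simpa [hn] using h1),
          indicator_of_notMem (fun h => h1 h.2)]
        simp
    · rw [indicator_of_notMem (show r ∉ Ioi 0 from h0), indicator_of_notMem (fun h => h0 h.1)]

end
end

section
/- Fix m ≥ 1 and let ψ(x) = x^{m+1}/(m+1) and g(x) = x^m for x > 0. Let χ : ℝ → [0,1] be a smooth function with χ(s) = 1 for s ∈ [−1,1] and χ(s) = 0 for s ∉ [−2,2]. On the Euclidean ball B = B(0,ρ) ⊂ ℝ² (ρ > 0 sufficiently small) define u(x,y) = χ(y/ψ(|x|)) ln(1/|x|) for x ≠ 0 and u(0,y) = 0 for y ≠ 0, and let A(x,y) = diag(1, g(|x|)²) and f = ∇·A∇u computed classically for x ≠ 0. Then: (i) ∫_B (|u_x|² + g(|x|)²|u_y|²) dxdy < ∞ and u ∈ L²(B), so u belongs to the degenerate Sobolev space W_A^{1,2}(B); (ii) u is essentially unbounded on every neighborhood of the origin; (iii)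 u is a weak solution of ∇·A∇u = f in B, i.e. ∫_B ∇u·A∇φ dxdy = −∫_B f φ dxdy for every Lipschitz φ with compact support in B; and (iv) for q ≥ 1, f ∈ L^q(B) if and only if q < (m+2)/2. In particular, for the finitely degenerate operator L = ∂_x² + x^{2m}∂_y² there is an unbounded weak solution of Lu = f with f ∈ L^q(B) for every q < (m+2)/2. -/
open MeasureTheory Filter Topology Set ENNReal

noncomputable section

/-- Integration by parts, `C¹` against compactly supported Lipschitz. -/
lemma ibp_aux {G φ : ℝ × ℝ → ℝ} (hG : ContDiff ℝ 1 G) {L : NNReal} (hφ : LipschitzWith L φ)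
    (hc : HasCompactSupport φ) (v : ℝ × ℝ) :
    ∫ p, G p * fderiv ℝ φ p v = - ∫ p, fderiv ℝ G p v * φ p := by
  obtain ⟨R, hR⟩ := hc.isCompact.isBounded.subset_ball (0 : ℝ × ℝ)
  let b : ContDiffBump (0 : ℝ × ℝ) :=
    ⟨max R 1, max R 1 + 1, by positivity, by linarith⟩
  have hR' : tsupport φ ⊆ Metric.ball (0 : ℝ × ℝ) (max R 1) :=
    hR.trans (Metric.ball_subset_ball (le_max_left _ _))
  have hbG : ContDiff ℝ 1 (fun p => b p * G p) := (b.contDiff (n := 1)).mul hG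
  have hbc : HasCompactSupport (fun p => b p * G p) := b.hasCompactSupport.mul_right
  obtain ⟨D, hD⟩ := ContDiff.lipschitzWith_of_hasCompactSupport hbc hbG (by simp)
  have key := LipschitzWith.integral_lineDeriv_mul_eq (μ := volume) hφ hD hbc v
  have h0 : ∀ p, p ∉ tsupport φ → fderiv ℝ φ p v = 0 := by
    intro p hp
    have : fderiv ℝ φ p = 0 := by
      by_contra h
      exact hp (support_fderiv_subset ℝ h)
    simp [this]
  have e1 : ∫ p, lineDeriv ℝ φ p v * (b p * G p) = ∫ p, G p * fderiv ℝ φ p v := by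
    apply integral_congr_ae
    filter_upwards [hφ.ae_differentiableAt (μ := volume)] with p hp
    rw [hp.lineDeriv_eq_fderiv]
    by_cases h : p ∈ tsupport φ
    · rw [b.one_of_mem_closedBall (Metric.ball_subset_closedBall (hR' h))]; ring
    · rw [h0 p h]; ring
  have e2 : ∫ p, lineDeriv ℝ (fun p => b p * G p) p (-v) * φ p
      = ∫ p, - (fderiv ℝ G p v * φ p) := by
    apply integral_congr_ae
    refine Eventually.of_forall fun p => ?_
    simp only
    by_cases h : p ∈ tsupport φ
    · rw [(hbG.differentiable (by simp)).differentiableAt.lineDeriv_eq_fderiv]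
      have : (fun p => b p * G p) =ᶠ[𝓝 p] G := by
        filter_upwards [Metric.isOpen_ball.mem_nhds (hR' h)] with z hz
        rw [b.one_of_mem_closedBall (Metric.ball_subset_closedBall hz)]; ring
      rw [this.fderiv_eq]; simp
    · rw [image_eq_zero_of_notMem_tsupport h]; ring
  rw [e1, e2, integral_neg] at key
  exact key

/-- Power function restricted to the cusp region. -/
def cuspV (a β : ℝ) (p : ℝ × ℝ) : ℝ :=
  if |p.2| ≤ 2 / a * |p.1| ^ a then |p.1| ^ (-β) else 0

lemma cuspV_nonneg (a β : ℝ) (p : ℝ × ℝ) : 0 ≤ cuspV a β p := by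
  unfold cuspV; split_ifs <;> positivity

lemma measurable_cuspV (a β : ℝ) : Measurable (cuspV a β) := by
  unfold cuspV
  refine Measurable.ite ?_ (by fun_prop) measurable_const
  exact measurableSet_le (by fun_prop) (by fun_prop)

lemma lintegral_abs_rpow {s : ℝ} (hs : -1 < s) :
    ∫⁻ x in Ioo (-1 : ℝ) 1, ENNReal.ofReal (|x| ^ s) < ⊤ := by
  have h1 : ∫⁻ x in Ioo (0 : ℝ) 1, ENNReal.ofReal (|x| ^ s) < ⊤ := by
    have := ((intervalIntegral.integrableOn_Ioo_rpow_iff (s := s) one_pos).2 hs)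
    refine lt_of_eq_of_lt (setLIntegral_congr_fun measurableSet_Ioo fun x hx => ?_)
      this.lintegral_lt_top
    simp only [abs_of_pos hx.1]
  have h2 : ∫⁻ x in Ioo (-1 : ℝ) 0, ENNReal.ofReal (|x| ^ s) < ⊤ := by
    have := (Measure.measurePreserving_neg (volume : Measure ℝ)).setLIntegral_comp_preimage
      (s := Ioo (0 : ℝ) 1) measurableSet_Ioo (f := fun x => ENNReal.ofReal (|x| ^ s)) (by fun_prop)
    simp only [abs_neg] at this
    have e : (Neg.neg ⁻¹' Ioo (0 : ℝ) 1) = Ioo (-1 : ℝ) 0 := by ext; simp [and_comm, neg_lt]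
    rw [e] at this
    rw [this]; exact h1
  have hsub : Ioo (-1 : ℝ) 1 ⊆ (Ioo (-1 : ℝ) 0 ∪ Ioo (0 : ℝ) 1) ∪ {0} := by
    intro x hx
    rcases lt_trichotomy x 0 with h | h | h
    · exact Or.inl (Or.inl ⟨hx.1, h⟩)
    · exact Or.inr h
    · exact Or.inl (Or.inr ⟨h, hx.2⟩)
  refine (lintegral_mono_set hsub).trans_lt ?_
  refine (lintegral_union_le _ _ _).trans_lt (ENNReal.add_lt_top.2 ⟨?_, by simp⟩)
  exact (lintegral_union_le _ _ _).trans_lt (ENNReal.add_lt_top.2 ⟨h2, h1⟩)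

lemma lintegral_cuspV {a β : ℝ} (ha : 0 < a) (hβ : β < a + 1) :
    ∫⁻ p in {p : ℝ × ℝ | |p.1| < 1}, ENNReal.ofReal (cuspV a β p) < ⊤ := by
  have hset : {p : ℝ × ℝ | |p.1| < 1} = Ioo (-1 : ℝ) 1 ×ˢ univ := by
    ext p; simp [abs_lt]
  rw [hset, Measure.volume_eq_prod, ← Measure.prod_restrict, Measure.restrict_univ,
    lintegral_prod _ (measurable_cuspV a β).ennreal_ofReal.aemeasurable]
  have hb : ∀ x : ℝ, x ≠ 0 → ∫⁻ y, ENNReal.ofReal (cuspV a β (x, y))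
      = ENNReal.ofReal (4 / a) * ENNReal.ofReal (|x| ^ (a - β)) := by
    intro x hx
    have hx' : 0 < |x| := abs_pos.2 hx
    have : (fun y => ENNReal.ofReal (cuspV a β (x, y))) =
        (Icc (-(2 / a * |x| ^ a)) (2 / a * |x| ^ a)).indicator
          (fun _ => ENNReal.ofReal (|x| ^ (-β))) := by
      funext y
      simp only [cuspV, indicator, mem_Icc, ← abs_le]
      split_ifs <;> simp
    rw [this, lintegral_indicator measurableSet_Icc, setLIntegral_const, Real.volume_Icc,
      ← ENNReal.ofReal_mul (by positivity), ← ENNReal.ofReal_mul (by positivity)]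
    congr 1
    rw [sub_eq_add_neg a β, Real.rpow_add hx']; ring
  have : ∫⁻ x in Ioo (-1 : ℝ) 1, ∫⁻ y, ENNReal.ofReal (cuspV a β (x, y))
      = ∫⁻ x in Ioo (-1 : ℝ) 1, ENNReal.ofReal (4 / a) * ENNReal.ofReal (|x| ^ (a - β)) := by
    apply lintegral_congr_ae
    apply ae_restrict_of_ae
    have : ∀ᵐ x : ℝ, x ≠ 0 := by simp [ae_iff]
    filter_upwards [this] with x hx using hb x hx
  rw [this, lintegral_const_mul _ (by fun_prop)]
  exact ENNReal.mul_lt_top (by simp) (lintegral_abs_rpow (by linarith))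

/-- Inner cusp. -/
def cuspT (a r : ℝ) : Set (ℝ × ℝ) := {p | (0 < p.1 ∧ p.1 < r) ∧ (0 < p.2 ∧ p.2 < p.1 ^ a / a)}

lemma isOpen_cuspT {a : ℝ} (ha : 0 < a) (r : ℝ) : IsOpen (cuspT a r) := by
  have h : Continuous (fun p : ℝ × ℝ => p.1 ^ a / a) := by
    have := Real.continuous_rpow_const ha.le
    fun_prop
  exact ((isOpen_lt continuous_const continuous_fst).inter
    (isOpen_lt continuous_fst continuous_const)).inter
    ((isOpen_lt continuous_const continuous_snd).inter (isOpen_lt continuous_snd h))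

lemma lintegral_cuspT {a r s : ℝ} (ha : 0 < a) (hr : 0 < r) (hs : s + a ≤ -1) :
    ∫⁻ p in cuspT a r, ENNReal.ofReal (p.1 ^ s) = ⊤ := by
  have hm := (isOpen_cuspT ha r).measurableSet
  rw [← lintegral_indicator hm, Measure.volume_eq_prod, lintegral_prod _
    (Measurable.indicator (by fun_prop) hm).aemeasurable]
  have hb : ∀ x : ℝ, ∫⁻ y, (cuspT a r).indicator (fun p => ENNReal.ofReal (p.1 ^ s)) (x, y)
      = (Ioo 0 r).indicator (fun x => ENNReal.ofReal (1 / a) * ENNReal.ofReal (x ^ (s + a))) x := by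
    intro x
    by_cases hx : x ∈ Ioo 0 r
    · have : (fun y => (cuspT a r).indicator (fun p => ENNReal.ofReal (p.1 ^ s)) (x, y)) =
          (Ioo 0 (x ^ a / a)).indicator (fun _ => ENNReal.ofReal (x ^ s)) := by
        funext y
        have : (0 < x ∧ x < r) := hx
        simp only [cuspT, indicator, mem_ofPred_eq, this, mem_Ioo, true_and, and_self]
      rw [this, lintegral_indicator measurableSet_Ioo, setLIntegral_const, Real.volume_Ioo,
        indicator_of_mem hx, ← ENNReal.ofReal_mul (Real.rpow_nonneg hx.1.le _),
        ← ENNReal.ofReal_mul (by positivity)]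
      congr 1
      rw [Real.rpow_add hx.1]; ring
    · rw [indicator_of_notMem hx]
      have : (fun y => (cuspT a r).indicator (fun p => ENNReal.ofReal (p.1 ^ s)) (x, y)) =
          fun _ => 0 := by
        funext y
        apply indicator_of_notMem
        exact fun h => hx h.1
      rw [this]; simp
  simp_rw [hb]
  rw [lintegral_indicator measurableSet_Ioo, lintegral_const_mul _ (by fun_prop)]
  have : ∫⁻ x in Ioo 0 r, ENNReal.ofReal (x ^ (s + a)) = ⊤ := by
    by_contra h
    have hi : IntegrableOn (fun x : ℝ => x ^ (s + a)) (Ioo 0 r) := by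
      refine ⟨by fun_prop, ?_⟩
      rw [hasFiniteIntegral_iff_ofReal]
      · exact lt_top_iff_ne_top.2 h
      · filter_upwards [ae_restrict_mem measurableSet_Ioo] with x hx using Real.rpow_nonneg hx.1.le _
    have := (intervalIntegral.integrableOn_Ioo_rpow_iff hr).1 hi
    linarith
  rw [this]
  exact ENNReal.mul_top (by simpa using ha)

def cS (a : ℝ) (p : ℝ × ℝ) : ℝ := a * p.2 * Real.exp (-(a * Real.log p.1))

def cU (a : ℝ) (χ : ℝ → ℝ) (p : ℝ × ℝ) : ℝ := χ (cS a p) * (-Real.log p.1)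

def cUX (a : ℝ) (χ : ℝ → ℝ) (p : ℝ × ℝ) : ℝ :=
  p.1⁻¹ * (a * cS a p * deriv χ (cS a p) * Real.log p.1 - χ (cS a p))

def cUY (a : ℝ) (χ : ℝ → ℝ) (p : ℝ × ℝ) : ℝ :=
  a * Real.exp (-(a * Real.log p.1)) * deriv χ (cS a p) * (-Real.log p.1)

def cF (a : ℝ) (χ : ℝ → ℝ) (p : ℝ × ℝ) : ℝ :=
  (p.1 ^ 2)⁻¹ * (-(a ^ 2 * (1 + cS a p ^ 2) * deriv (deriv χ) (cS a p)
    + (a ^ 2 + a) * (cS a p * deriv χ (cS a p))) * Real.log p.1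
    + 2 * a * (cS a p * deriv χ (cS a p)) + χ (cS a p))

lemma contDiffAt_cS (a : ℝ) {p : ℝ × ℝ} (hp : p.1 ≠ 0) : ContDiffAt ℝ 2 (cS a) p := by
  unfold cS
  have := (contDiffAt_fst (𝕜 := ℝ) (n := 2) (p := p)).log hp
  fun_prop

lemma contDiffAt_comp_cS (a : ℝ) {h : ℝ → ℝ} {n : WithTop ℕ∞} (hn : n ≤ 2) (hh : ContDiff ℝ n h)
    {p : ℝ × ℝ} (hp : p.1 ≠ 0) : ContDiffAt ℝ n (fun p => h (cS a p)) p :=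
  hh.contDiffAt.comp p ((contDiffAt_cS a hp).of_le hn)

lemma fderiv_fst_of {F : ℝ × ℝ → ℝ} {p : ℝ × ℝ} {d : ℝ} (hF : DifferentiableAt ℝ F p)
    (hd : HasDerivAt (fun t => F (t, p.2)) d p.1) : fderiv ℝ F p (1, 0) = d := by
  have h1 : HasDerivAt (fun t : ℝ => (t, p.2)) ((1 : ℝ), (0 : ℝ)) p.1 :=
    (hasDerivAt_id _).prodMk (hasDerivAt_const _ _)
  have h2 : HasFDerivAt F (fderiv ℝ F p) (p.1, p.2) := hF.hasFDerivAt
  exact (h2.comp_hasDerivAt p.1 h1).unique hd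

lemma fderiv_snd_of {F : ℝ × ℝ → ℝ} {p : ℝ × ℝ} {d : ℝ} (hF : DifferentiableAt ℝ F p)
    (hd : HasDerivAt (fun t => F (p.1, t)) d p.2) : fderiv ℝ F p (0, 1) = d := by
  have h1 : HasDerivAt (fun t : ℝ => (p.1, t)) ((0 : ℝ), (1 : ℝ)) p.2 :=
    (hasDerivAt_const _ _).prodMk (hasDerivAt_id _)
  have h2 : HasFDerivAt F (fderiv ℝ F p) (p.1, p.2) := hF.hasFDerivAt
  exact (h2.comp_hasDerivAt p.2 h1).unique hd

lemma hasDerivAt_cS_fst (a : ℝ) {p : ℝ × ℝ} (hp : p.1 ≠ 0) :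
    HasDerivAt (fun t => cS a (t, p.2)) (-(a * cS a p * p.1⁻¹)) p.1 := by
  have h := ((((Real.hasDerivAt_log hp).const_mul a).neg).exp).const_mul (a * p.2)
  refine h.congr_deriv ?_
  simp only [cS, Pi.neg_apply]; ring

lemma hasDerivAt_cS_snd (a : ℝ) (p : ℝ × ℝ) :
    HasDerivAt (fun t => cS a (p.1, t)) (a * Real.exp (-(a * Real.log p.1))) p.2 := by
  have h := (((hasDerivAt_id p.2).const_mul a).mul_const (Real.exp (-(a * Real.log p.1))))
  refine h.congr_deriv ?_
  simp

lemma hasDerivAt_comp_fst (a : ℝ) {h : ℝ → ℝ} (hh : Differentiable ℝ h) {p : ℝ × ℝ}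
    (hp : p.1 ≠ 0) :
    HasDerivAt (fun t => h (cS a (t, p.2))) (deriv h (cS a p) * (-(a * cS a p * p.1⁻¹))) p.1 :=
  HasDerivAt.comp p.1 (h₂ := h) (h := fun t => cS a (t, p.2)) (hh (cS a p)).hasDerivAt
    (hasDerivAt_cS_fst a hp)

lemma hasDerivAt_comp_snd (a : ℝ) {h : ℝ → ℝ} (hh : Differentiable ℝ h) (p : ℝ × ℝ) :
    HasDerivAt (fun t => h (cS a (p.1, t)))
      (deriv h (cS a p) * (a * Real.exp (-(a * Real.log p.1)))) p.2 :=
  HasDerivAt.comp p.2 (h₂ := h) (h := fun t => cS a (p.1, t)) (hh (cS a p)).hasDerivAt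
    (hasDerivAt_cS_snd a p)

section
variable {a : ℝ} {χ : ℝ → ℝ} {p : ℝ × ℝ}

lemma contDiff_derivs (hχ : ContDiff ℝ (⊤ : ℕ∞) χ) :
    ContDiff ℝ (⊤ : ℕ∞) (deriv χ) ∧ ContDiff ℝ (⊤ : ℕ∞) (deriv (deriv χ)) := by
  have h1 : ContDiff ℝ (⊤ : ℕ∞) (deriv χ) := (contDiff_infty_iff_deriv.1 hχ).2
  exact ⟨h1, (contDiff_infty_iff_deriv.1 h1).2⟩

lemma contDiffAt_cU (hχ : ContDiff ℝ (⊤ : ℕ∞) χ) (hp : p.1 ≠ 0) : ContDiffAt ℝ 1 (cU a χ) p := by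
  have h1 := contDiffAt_comp_cS a (h := χ) (n := 1) (by norm_num) (hχ.of_le (by exact_mod_cast le_top)) hp
  have := (contDiffAt_fst (𝕜 := ℝ) (n := 1) (p := p)).log hp
  unfold cU
  exact h1.mul this.neg

lemma contDiffAt_cUX (hχ : ContDiff ℝ (⊤ : ℕ∞) χ) (hp : p.1 ≠ 0) :
    ContDiffAt ℝ 1 (cUX a χ) p := by
  have h0 := (contDiffAt_cS a hp).of_le (m := 1) (by norm_num)
  have h1 := contDiffAt_comp_cS a (h := χ) (n := 1) (by norm_num) (hχ.of_le (by exact_mod_cast le_top)) hp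
  have h2 := contDiffAt_comp_cS a (h := deriv χ) (n := 1) (by norm_num)
    ((contDiff_derivs hχ).1.of_le (by exact_mod_cast le_top)) hp
  have := (contDiffAt_fst (𝕜 := ℝ) (n := 1) (p := p)).log hp
  have h3 := (contDiffAt_fst (𝕜 := ℝ) (n := 1) (p := p)).inv hp
  unfold cUX
  exact h3.mul ((((contDiffAt_const.mul h0).mul h2).mul this).sub h1)

lemma contDiffAt_cUY (hχ : ContDiff ℝ (⊤ : ℕ∞) χ) (hp : p.1 ≠ 0) :
    ContDiffAt ℝ 1 (cUY a χ) p := by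
  have h2 := contDiffAt_comp_cS a (h := deriv χ) (n := 1) (by norm_num)
    ((contDiff_derivs hχ).1.of_le (by exact_mod_cast le_top)) hp
  have := (contDiffAt_fst (𝕜 := ℝ) (n := 1) (p := p)).log hp
  unfold cUY
  exact ((contDiffAt_const.mul (contDiffAt_const.mul this).neg.exp).mul h2).mul this.neg

lemma fderiv_cU_fst (hχ : ContDiff ℝ (⊤ : ℕ∞) χ) (hp : p.1 ≠ 0) :
    fderiv ℝ (cU a χ) p (1, 0) = cUX a χ p := by
  refine fderiv_fst_of ((contDiffAt_cU hχ hp).differentiableAt (by simp)) ?_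
  have h := (hasDerivAt_comp_fst a (hχ.differentiable (by simp)) hp).mul
    (Real.hasDerivAt_log hp).neg
  refine h.congr_deriv ?_
  simp only [cUX, Pi.neg_apply]; ring

lemma fderiv_cU_snd (hχ : ContDiff ℝ (⊤ : ℕ∞) χ) (hp : p.1 ≠ 0) :
    fderiv ℝ (cU a χ) p (0, 1) = cUY a χ p := by
  refine fderiv_snd_of ((contDiffAt_cU hχ hp).differentiableAt (by simp)) ?_
  have h := (hasDerivAt_comp_snd a (hχ.differentiable (by simp)) p).mul_const (-Real.log p.1)
  refine h.congr_deriv ?_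
  simp only [cUY]; ring

lemma fderiv_cUX_fst (hχ : ContDiff ℝ (⊤ : ℕ∞) χ) (hp : p.1 ≠ 0) :
    fderiv ℝ (cUX a χ) p (1, 0) = (p.1 ^ 2)⁻¹ *
      (-(a ^ 2 * (cS a p ^ 2) * deriv (deriv χ) (cS a p)
    + (a ^ 2 + a) * (cS a p * deriv χ (cS a p))) * Real.log p.1
    + 2 * a * (cS a p * deriv χ (cS a p)) + χ (cS a p)) := by
  refine fderiv_fst_of ((contDiffAt_cUX hχ hp).differentiableAt (by simp)) ?_
  have h := (hasDerivAt_inv hp).mul (((((hasDerivAt_cS_fst a hp).const_mul a).mul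
    (hasDerivAt_comp_fst a ((contDiff_derivs hχ).1.differentiable (by simp)) hp)).mul
      (Real.hasDerivAt_log hp)).sub (hasDerivAt_comp_fst a (hχ.differentiable (by simp)) hp))
  refine h.congr_deriv ?_
  simp only [Pi.mul_apply, Pi.sub_apply, Prod.mk.eta]
  field_simp
  ring

lemma fderiv_cUY_snd (hχ : ContDiff ℝ (⊤ : ℕ∞) χ) (hp : p.1 ≠ 0) :
    fderiv ℝ (cUY a χ) p (0, 1) = (a * Real.exp (-(a * Real.log p.1))) ^ 2 *
      deriv (deriv χ) (cS a p) * (-Real.log p.1) := by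
  refine fderiv_snd_of ((contDiffAt_cUY hχ hp).differentiableAt (by simp)) ?_
  have h := ((hasDerivAt_comp_snd a ((contDiff_derivs hχ).1.differentiable (by simp)) p).const_mul
    (a * Real.exp (-(a * Real.log p.1)))).mul_const (-Real.log p.1)
  refine h.congr_deriv ?_
  ring

lemma exp_mul_log_eq {x : ℝ} (hx : x ≠ 0) (b : ℝ) : Real.exp (b * Real.log x) = |x| ^ b := by
  rw [Real.rpow_def_of_pos (abs_pos.2 hx), Real.log_abs, mul_comm]

lemma cF_eq {m : ℝ} (hχ : ContDiff ℝ (⊤ : ℕ∞) χ) (hp : p.1 ≠ 0) :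
    fderiv ℝ (cUX (m + 1) χ) p (1, 0) + (|p.1| ^ m) ^ 2 * fderiv ℝ (cUY (m + 1) χ) p (0, 1)
      = cF (m + 1) χ p := by
  rw [fderiv_cUX_fst hχ hp, fderiv_cUY_snd hχ hp, ← neg_mul, exp_mul_log_eq hp, cF]
  have h : |p.1| ^ m * |p.1| ^ (-(m + 1)) = |p.1|⁻¹ := by
    rw [← Real.rpow_add (abs_pos.2 hp), ← Real.rpow_neg_one]; congr 1; ring
  have h2 : (|p.1| ^ m) ^ 2 * (|p.1| ^ (-(m + 1))) ^ 2 = (p.1 ^ 2)⁻¹ := by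
    rw [← mul_pow, h, inv_pow, sq_abs]
  rw [mul_pow]
  linear_combination ((m + 1) ^ 2 * deriv (deriv χ) (cS (m + 1) p) * (-Real.log p.1)) * h2

end

lemma cutoff_vanish {χ : ℝ → ℝ} (hz : ∀ s, s ∉ Set.Icc (-2 : ℝ) 2 → χ s = 0) :
    ∀ s, s ∉ Set.Icc (-2 : ℝ) 2 → deriv χ s = 0 := by
  intro s hs
  have : χ =ᶠ[𝓝 s] fun _ => 0 := by
    filter_upwards [isClosed_Icc.isOpen_compl.mem_nhds hs] with t ht using hz t ht
  rw [this.deriv_eq]; simp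

lemma cutoff_bound {h : ℝ → ℝ} (hc : Continuous h)
    (hz : ∀ s, s ∉ Set.Icc (-2 : ℝ) 2 → h s = 0) : ∃ C, 0 ≤ C ∧ ∀ s, |h s| ≤ C := by
  obtain ⟨C, hC⟩ := isCompact_Icc.exists_bound_of_continuousOn (s := Icc (-2 : ℝ) 2) hc.continuousOn
  refine ⟨max C 0, le_max_right _ _, fun s => ?_⟩
  by_cases hs : s ∈ Icc (-2 : ℝ) 2
  · exact (hC s hs).trans (le_max_left _ _)
  · rw [hz s hs]; simp

lemma one_add_log_le {δ x : ℝ} (hδ : 0 < δ) (hx : x ≠ 0) (hx1 : |x| < 1) :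
    1 + |Real.log x| ≤ (1 + 1 / δ) * |x| ^ (-δ) := by
  have hx0 := abs_pos.2 hx
  have h1 : 1 ≤ |x| ^ (-δ) := Real.one_le_rpow_of_pos_of_le_one_of_nonpos hx0 hx1.le (by linarith)
  have h2 : |Real.log x| ≤ |x| ^ (-δ) / δ := by
    have := Real.log_le_rpow_div (x := |x|⁻¹) (by positivity) hδ
    rw [Real.log_inv, Real.inv_rpow hx0.le, ← Real.rpow_neg hx0.le] at this
    rw [← Real.log_abs, abs_of_nonpos (Real.log_nonpos hx0.le hx1.le)]
    exact this
  calc 1 + |Real.log x| ≤ |x| ^ (-δ) + |x| ^ (-δ) / δ := by linarith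
    _ = _ := by ring

lemma cS_mem {a : ℝ} (ha : 0 < a) {p : ℝ × ℝ} (hp : p.1 ≠ 0) :
    cS a p ∈ Icc (-2 : ℝ) 2 ↔ |p.2| ≤ 2 / a * |p.1| ^ a := by
  have hx0 := abs_pos.2 hp
  have hpos : 0 < |p.1| ^ a := by positivity
  rw [mem_Icc, ← abs_le, cS, ← neg_mul, exp_mul_log_eq hp, Real.rpow_neg hx0.le, abs_mul, abs_mul,
    abs_of_pos ha, abs_of_pos (inv_pos.2 hpos), ← div_eq_mul_inv, div_le_iff₀ hpos, div_mul_eq_mul_div,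
    le_div_iff₀ ha, mul_comm a]

lemma cusp_bounds {m : ℝ} (hm : 1 ≤ m) {χ : ℝ → ℝ} (hχ : ContDiff ℝ (⊤ : ℕ∞) χ)
    (hz : ∀ s, s ∉ Set.Icc (-2 : ℝ) 2 → χ s = 0) {δ : ℝ} (hδ : 0 < δ) :
    ∃ C, 0 ≤ C ∧ ∀ p : ℝ × ℝ, p.1 ≠ 0 → |p.1| < 1 →
      |cU (m + 1) χ p| ≤ C * cuspV (m + 1) δ p ∧
      |cUX (m + 1) χ p| ≤ C * cuspV (m + 1) (1 + δ) p ∧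
      |(|p.1| ^ m) * cUY (m + 1) χ p| ≤ C * cuspV (m + 1) (1 + δ) p ∧
      |cF (m + 1) χ p| ≤ C * cuspV (m + 1) (2 + δ) p := by
  have hz1 := cutoff_vanish hz
  have hz2 := cutoff_vanish hz1
  obtain ⟨hd1, hd2⟩ := contDiff_derivs hχ
  have c0 := hχ.continuous
  have c1 := hd1.continuous
  have c2 := hd2.continuous
  obtain ⟨C0, p0, b0⟩ := cutoff_bound c0 hz
  obtain ⟨C1, p1, b1⟩ := cutoff_bound c1 hz1
  obtain ⟨C2, p2, b2⟩ := cutoff_bound (h := fun s => s * deriv χ s) (by fun_prop)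
    (fun s hs => by simp [hz1 s hs])
  obtain ⟨C3, p3, b3⟩ := cutoff_bound (h := fun s => (1 + s ^ 2) * deriv (deriv χ) s) (by fun_prop)
    (fun s hs => by simp [hz2 s hs])
  set a := m + 1 with ha_def
  have ha : 0 < a := by linarith
  set K := 1 + 1 / δ with hK
  have hKpos : 0 < K := by positivity
  set D := C0 + a * C1 + a * C2 + (a ^ 2 * C3 + (a ^ 2 + a) * C2 + 2 * a * C2 + C0) with hD
  have hDp : 0 ≤ D := by positivity
  refine ⟨D * K, by positivity, fun p hp hp1 => ?_⟩
  have hx0 := abs_pos.2 hp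
  by_cases hs : cS a p ∈ Icc (-2 : ℝ) 2
  · have hV : ∀ β, cuspV a β p = |p.1| ^ (-β) := fun β => by
      rw [cuspV, if_pos ((cS_mem ha hp).1 hs)]
    have hlog := one_add_log_le hδ hp hp1
    rw [← hK] at hlog
    have e1 : |p.1| ^ (-(1 + δ)) = |p.1|⁻¹ * |p.1| ^ (-δ) := by
      rw [← Real.rpow_neg_one, ← Real.rpow_add hx0]; congr 1; ring
    have e2 : |p.1| ^ (-(2 + δ)) = (p.1 ^ 2)⁻¹ * |p.1| ^ (-δ) := by
      rw [← sq_abs, ← Real.rpow_natCast, ← Real.rpow_neg hx0.le, ← Real.rpow_add hx0]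
      congr 1; push_cast; ring
    set l := Real.log p.1
    set w := |p.1| ^ (-δ)
    have hl : 0 ≤ |l| := abs_nonneg _
    have main : ∀ (X A B : ℝ), |X| ≤ A * |l| + B → A ≤ D → B ≤ D → |X| ≤ D * K * w := by
      intro X A B h hA hB
      calc |X| ≤ A * |l| + B := h
        _ ≤ D * |l| + D := by gcongr
        _ = D * (1 + |l|) := by ring
        _ ≤ D * (K * w) := by gcongr
        _ = _ := by ring
    have B0 := b0 (cS a p)
    have B1 := b1 (cS a p)
    have B2 := b2 (cS a p)
    have B3 := b3 (cS a p)
    simp only [hV]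
    have t1 : 0 ≤ a * C1 := by positivity
    have t2 : 0 ≤ a * C2 := by positivity
    have t3 : 0 ≤ a ^ 2 * C3 := by positivity
    have t4 : 0 ≤ (a ^ 2 + a) * C2 := by positivity
    refine ⟨?_, ?_, ?_, ?_⟩
    · refine main _ C0 0 ?_ (by linarith) hDp
      rw [cU, abs_mul, abs_neg, add_zero]
      gcongr
    · rw [cUX, abs_mul, abs_inv, e1]
      have := main (a * cS a p * deriv χ (cS a p) * l - χ (cS a p)) (a * C2) C0 ?_
        (by linarith) (by linarith)
      · calc _ ≤ |p.1|⁻¹ * (D * K * w) := by gcongr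
          _ = _ := by ring
      · refine (abs_sub _ _).trans ?_
        rw [abs_mul, mul_assoc a, abs_mul a, abs_of_pos ha]
        gcongr
    · have h : |p.1| ^ m * |p.1| ^ (-a) = |p.1|⁻¹ := by
        rw [← Real.rpow_add hx0, ← Real.rpow_neg_one]; congr 1; rw [ha_def]; ring
      have : |p.1| ^ m * cUY a χ p = |p.1|⁻¹ * (a * deriv χ (cS a p) * -l) := by
        rw [cUY, ← neg_mul, exp_mul_log_eq hp, ← h]; ring
      rw [this, e1, abs_mul, abs_of_pos (inv_pos.2 hx0)]
      have := main (a * deriv χ (cS a p) * -l) (a * C1) 0 ?_ (by linarith) hDp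
      · calc _ ≤ |p.1|⁻¹ * (D * K * w) := by gcongr
          _ = _ := by ring
      · rw [abs_mul, abs_mul a, abs_of_pos ha, abs_neg, add_zero]
        gcongr
    · rw [cF, e2, abs_mul, abs_of_pos (a := (p.1 ^ 2)⁻¹) (by positivity)]
      have := main (-(a ^ 2 * (1 + cS a p ^ 2) * deriv (deriv χ) (cS a p)
          + (a ^ 2 + a) * (cS a p * deriv χ (cS a p))) * l
          + 2 * a * (cS a p * deriv χ (cS a p)) + χ (cS a p))
        (a ^ 2 * C3 + (a ^ 2 + a) * C2) (2 * a * C2 + C0) ?_ (by linarith) (by linarith)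
      · calc _ ≤ (p.1 ^ 2)⁻¹ * (D * K * w) := by gcongr
          _ = _ := by ring
      · refine (abs_add_le _ _).trans ?_
        rw [← add_assoc (_ * |l|)]
        refine add_le_add ((abs_add_le _ _).trans (add_le_add ?_ ?_)) B0
        · rw [abs_mul, abs_neg]
          gcongr
          refine (abs_add_le _ _).trans (add_le_add ?_ ?_)
          · rw [mul_assoc, abs_mul, abs_of_pos (a := a ^ 2) (by positivity)]; gcongr
          · rw [abs_mul, abs_of_pos (a := a ^ 2 + a) (by positivity)]; gcongr
        · rw [abs_mul, abs_of_pos (a := 2 * a) (by positivity)]; gcongr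
  · have hV : ∀ β, cuspV a β p = 0 := fun β => by
      rw [cuspV, if_neg (fun h => hs ((cS_mem ha hp).2 h))]
    simp [hV, cU, cUX, cUY, cF, hz _ hs, hz1 _ hs, hz2 _ hs]

/-- The strip `|x| < 1`. -/
def cStrip : Set (ℝ × ℝ) := {p | |p.1| < 1}

lemma measurableSet_cStrip : MeasurableSet cStrip :=
  measurableSet_lt (by fun_prop) (by fun_prop)

lemma ae_fst_ne : ∀ᵐ p : ℝ × ℝ, p.1 ≠ 0 := by
  have h : ∀ᵐ x : ℝ, x ≠ 0 := by simp [ae_iff]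
  rw [Measure.volume_eq_prod]
  exact (Measure.quasiMeasurePreserving_fst (μ := (volume : Measure ℝ))
    (ν := (volume : Measure ℝ))).ae h

lemma integrable_maj {a β : ℝ} (ha : 0 < a) (hβ : β < a + 1) (C : ℝ) :
    Integrable (cStrip.indicator (fun p => C * cuspV a β p)) := by
  rw [integrable_indicator_iff measurableSet_cStrip]
  refine Integrable.const_mul ?_ C
  refine ⟨(measurable_cuspV a β).aestronglyMeasurable, ?_⟩
  rw [hasFiniteIntegral_iff_ofReal (Eventually.of_forall fun p => cuspV_nonneg a β p)]
  exact lintegral_cuspV ha hβ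

lemma measurable_cS (a : ℝ) : Measurable (cS a) := by unfold cS; fun_prop

lemma measurable_cUX (a : ℝ) {χ : ℝ → ℝ} (hχ : Continuous χ) : Measurable (cUX a χ) := by
  have h := measurable_cS a
  have h1 : Measurable fun p => χ (cS a p) := hχ.measurable.comp h
  have h2 : Measurable fun p => deriv χ (cS a p) := (measurable_deriv χ).comp h
  unfold cUX; fun_prop

lemma measurable_cUY (a : ℝ) {χ : ℝ → ℝ} : Measurable (cUY a χ) := by
  have h := measurable_cS a
  have h2 : Measurable fun p => deriv χ (cS a p) := (measurable_deriv χ).comp h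
  unfold cUY; fun_prop

lemma measurable_cF (a : ℝ) {χ : ℝ → ℝ} (hχ : Continuous χ) : Measurable (cF a χ) := by
  have h := measurable_cS a
  have h1 : Measurable fun p => χ (cS a p) := hχ.measurable.comp h
  have h2 : Measurable fun p => deriv χ (cS a p) := (measurable_deriv χ).comp h
  have h3 : Measurable fun p => deriv (deriv χ) (cS a p) := (measurable_deriv _).comp h
  unfold cF; fun_prop

lemma cuspV_mono {a β γ : ℝ} (h : β ≤ γ) {p : ℝ × ℝ} (hp : p.1 ≠ 0) (hp1 : |p.1| < 1) :
    cuspV a β p ≤ cuspV a γ p := by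
  unfold cuspV
  split_ifs
  · exact Real.rpow_le_rpow_of_exponent_ge (abs_pos.2 hp) hp1.le (by linarith)
  · exact le_rfl

lemma inv_mul_cuspV {a β : ℝ} {p : ℝ × ℝ} (hp : p.1 ≠ 0) :
    |p.1|⁻¹ * cuspV a β p = cuspV a (1 + β) p := by
  unfold cuspV
  split_ifs
  · rw [← Real.rpow_neg_one, ← Real.rpow_add (abs_pos.2 hp)]; congr 1; ring
  · simp

/-- cutoff away from `x = 0` -/
def cEta (χ : ℝ → ℝ) (n : ℕ) (x : ℝ) : ℝ := 1 - χ ((n + 1) * x)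

lemma contDiff_cEta {χ : ℝ → ℝ} (hχ : ContDiff ℝ (⊤ : ℕ∞) χ) (n : ℕ) :
    ContDiff ℝ 1 (cEta χ n) := by
  have : ContDiff ℝ 1 χ := hχ.of_le (by exact_mod_cast le_top)
  unfold cEta
  fun_prop

lemma hasDerivAt_cEta {χ : ℝ → ℝ} (hχ : ContDiff ℝ (⊤ : ℕ∞) χ) (n : ℕ) (x : ℝ) :
    HasDerivAt (cEta χ n) (-((n + 1) * deriv χ ((n + 1) * x))) x := by
  have h1 : HasDerivAt (fun x : ℝ => ((n : ℝ) + 1) * x) ((n : ℝ) + 1) x := by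
    simpa using (hasDerivAt_id x).const_mul ((n : ℝ) + 1)
  have h2 := HasDerivAt.comp x (h₂ := χ)
    ((hχ.differentiable (by simp)) (((n : ℝ) + 1) * x)).hasDerivAt h1
  refine (h2.const_sub 1).congr_deriv ?_
  ring

lemma contDiff_cEta_mul {χ : ℝ → ℝ} (hχ : ContDiff ℝ (⊤ : ℕ∞) χ)
    (hone : ∀ s ∈ Set.Icc (-1 : ℝ) 1, χ s = 1) (n : ℕ) {G : ℝ × ℝ → ℝ}
    (hG : ∀ p : ℝ × ℝ, p.1 ≠ 0 → ContDiffAt ℝ 1 G p) :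
    ContDiff ℝ 1 (fun p => cEta χ n p.1 * G p) := by
  rw [contDiff_iff_contDiffAt]
  intro p
  by_cases hp : p.1 = 0
  · have : (fun p : ℝ × ℝ => cEta χ n p.1 * G p) =ᶠ[𝓝 p] fun _ => 0 := by
      have hc : Continuous fun q : ℝ × ℝ => ((n : ℝ) + 1) * q.1 := by fun_prop
      have := hc.continuousAt.preimage_mem_nhds (x := p) (t := Icc (-1 : ℝ) 1) (by
        rw [hp]; exact Icc_mem_nhds (by simp) (by simp))
      filter_upwards [this] with q hq
      rw [cEta, hone _ hq]; simp
    exact contDiffAt_const.congr_of_eventuallyEq this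
  · exact ((contDiff_cEta hχ n).comp contDiff_fst).contDiffAt.mul (hG p hp)

lemma fderiv_cEta_mul {χ : ℝ → ℝ} (hχ : ContDiff ℝ (⊤ : ℕ∞) χ) (n : ℕ) {G : ℝ × ℝ → ℝ}
    {p : ℝ × ℝ} (hG : DifferentiableAt ℝ G p) :
    fderiv ℝ (fun p => cEta χ n p.1 * G p) p (1, 0) = cEta χ n p.1 * fderiv ℝ G p (1, 0)
        - (n + 1) * deriv χ ((n + 1) * p.1) * G p ∧
    fderiv ℝ (fun p => cEta χ n p.1 * G p) p (0, 1) = cEta χ n p.1 * fderiv ℝ G p (0, 1) := by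
  have hE : DifferentiableAt ℝ (fun p : ℝ × ℝ => cEta χ n p.1) p :=
    (((contDiff_cEta hχ n).comp contDiff_fst).differentiable (by simp)) p
  have d1 := fderiv_fst_of hE (hasDerivAt_cEta hχ n p.1)
  have d2 := fderiv_snd_of hE (hasDerivAt_const p.2 (cEta χ n p.1))
  rw [fderiv_fun_mul hE hG]
  simp only [add_apply, smul_apply, smul_eq_mul, d1, d2]
  constructor <;> ring

lemma eventually_notMem {x : ℝ} (hx : x ≠ 0) :
    ∀ᶠ n : ℕ in atTop, ((n : ℝ) + 1) * x ∉ Icc (-2 : ℝ) 2 := by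
  have : Tendsto (fun n : ℕ => ((n : ℝ) + 1) * |x|) atTop atTop :=
    (tendsto_atTop_add_const_right _ _ tendsto_natCast_atTop_atTop).atTop_mul_const (abs_pos.2 hx)
  filter_upwards [this.eventually_gt_atTop 2] with n hn
  rw [mem_Icc, ← abs_le, abs_mul, abs_of_pos (by positivity : (0 : ℝ) < (n : ℝ) + 1)]
  exact not_le.2 hn

lemma cusp_weak {m : ℝ} (hm : 1 ≤ m) {χ : ℝ → ℝ} (hχ : ContDiff ℝ (⊤ : ℕ∞) χ)
    (h01 : ∀ s, 0 ≤ χ s ∧ χ s ≤ 1) (hone : ∀ s ∈ Set.Icc (-1 : ℝ) 1, χ s = 1)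
    (hz : ∀ s, s ∉ Set.Icc (-2 : ℝ) 2 → χ s = 0) {φ : ℝ × ℝ → ℝ} {L : NNReal}
    (hφ : LipschitzWith L φ) (hc : HasCompactSupport φ) (hsub : tsupport φ ⊆ cStrip) :
    ∫ p, (cUX (m + 1) χ p * fderiv ℝ φ p (1, 0)
      + (|p.1| ^ m) ^ 2 * cUY (m + 1) χ p * fderiv ℝ φ p (0, 1))
      = - ∫ p, cF (m + 1) χ p * φ p := by
  obtain ⟨C, hC0, hC⟩ := cusp_bounds hm hχ hz (δ := 1 / 2) (by norm_num)
  obtain ⟨C2, hC20, hC2⟩ := cutoff_bound (h := fun s => s * deriv χ s)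
    (by have := (contDiff_derivs hχ).1.continuous; fun_prop)
    (fun s hs => by simp [cutoff_vanish hz s hs])
  obtain ⟨P0, hP0⟩ := hφ.continuous.bounded_above_of_compact_support hc
  set P := max P0 L with hP
  have hPn : 0 ≤ P := le_max_of_le_right L.2
  have hφb : ∀ p, |φ p| ≤ P := fun p => (hP0 p).trans (le_max_left _ _)
  have hdb : ∀ p v, ‖v‖ ≤ 1 → |fderiv ℝ φ p v| ≤ P := fun p v hv => by
    refine ((fderiv ℝ φ p).le_of_opNorm_le (norm_fderiv_le_of_lipschitz ℝ hφ) v).trans ?_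
    calc (L : ℝ) * ‖v‖ ≤ L * 1 := by gcongr
      _ ≤ P := by simp [hP]
  have n1 : ‖((1 : ℝ), (0 : ℝ))‖ ≤ 1 := by simp [Prod.norm_def]
  have n2 : ‖((0 : ℝ), (1 : ℝ))‖ ≤ 1 := by simp [Prod.norm_def]
  have hφ0 : ∀ p, p ∉ cStrip → φ p = 0 := fun p hp =>
    image_eq_zero_of_notMem_tsupport fun h => hp (hsub h)
  have hd0 : ∀ p v, p ∉ cStrip → fderiv ℝ φ p v = 0 := by
    intro p v hp
    have : fderiv ℝ φ p = 0 := by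
      by_contra h
      exact hp (hsub (support_fderiv_subset ℝ h))
    simp [this]
  have hmφ : Measurable φ := hφ.continuous.measurable
  have hmd : ∀ v, Measurable fun p => fderiv ℝ φ p v := fun v => measurable_fderiv_apply_const ℝ φ v
  have hmX := measurable_cUX (m + 1) hχ.continuous
  have hmY := measurable_cUY (m + 1) (χ := χ)
  have hmF := measurable_cF (m + 1) hχ.continuous
  have hmE : ∀ n, Measurable fun p : ℝ × ℝ => cEta χ n p.1 := fun n =>
    ((contDiff_cEta hχ n).continuous.measurable).comp measurable_fst
  set a := m + 1 with ha_def
  have ha : 0 < a := by linarith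
  let g2 : ℝ × ℝ → ℝ := fun p => (|p.1| ^ m) ^ 2 * cUY a χ p
  have hmg : Measurable g2 := by fun_prop
  have hHint : ∀ K, Integrable (cStrip.indicator (fun p => K * cuspV a (2 + 1 / 2) p)) :=
    integrable_maj ha (by linarith)
  -- pointwise bounds
  have bX : ∀ p : ℝ × ℝ, p.1 ≠ 0 → |p.1| < 1 → |cUX a χ p| ≤ C * cuspV a (2 + 1 / 2) p :=
    fun p hp hp1 => ((hC p hp hp1).2.1).trans
      (mul_le_mul_of_nonneg_left (cuspV_mono (by norm_num) hp hp1) hC0)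
  have bY : ∀ p : ℝ × ℝ, p.1 ≠ 0 → |p.1| < 1 → |g2 p| ≤ C * cuspV a (2 + 1 / 2) p := by
    intro p hp hp1
    have h1 : |p.1| ^ m ≤ 1 := Real.rpow_le_one (abs_nonneg _) hp1.le (by linarith)
    have h2 : 0 ≤ |p.1| ^ m := by positivity
    calc |g2 p| = |p.1| ^ m * |(|p.1| ^ m) * cUY a χ p| := by
          rw [← abs_of_nonneg h2, ← abs_mul, abs_of_nonneg h2]; congr 1; simp only [g2]; ring
      _ ≤ 1 * |(|p.1| ^ m) * cUY a χ p| := by gcongr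
      _ ≤ C * cuspV a (1 + 1 / 2) p := by rw [one_mul]; exact (hC p hp hp1).2.2.1
      _ ≤ _ := mul_le_mul_of_nonneg_left (cuspV_mono (by norm_num) hp hp1) hC0
  have bF : ∀ p : ℝ × ℝ, p.1 ≠ 0 → |p.1| < 1 → |cF a χ p| ≤ C * cuspV a (2 + 1 / 2) p :=
    fun p hp hp1 => (hC p hp hp1).2.2.2
  have bE : ∀ n x, |cEta χ n x| ≤ 1 := by
    intro n x
    have := h01 ((n + 1) * x)
    rw [cEta, abs_le]; constructor <;> linarith
  have bE' : ∀ (n : ℕ) (p : ℝ × ℝ), p.1 ≠ 0 → |p.1| < 1 →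
      |((n : ℝ) + 1) * deriv χ ((n + 1) * p.1) * cUX a χ p| ≤ C2 * C * cuspV a (2 + 1 / 2) p := by
    intro n p hp hp1
    have h1 : |((n : ℝ) + 1) * deriv χ ((n + 1) * p.1)| ≤ C2 * |p.1|⁻¹ := by
      rw [← div_eq_mul_inv, le_div_iff₀ (abs_pos.2 hp), ← abs_mul]
      have := hC2 ((n + 1) * p.1)
      have e : ((n : ℝ) + 1) * deriv χ ((n + 1) * p.1) * p.1
          = ((n + 1) * p.1) * deriv χ ((n + 1) * p.1) := by ring
      rw [e]; exact this
    have e : cuspV a (2 + 1 / 2) p = |p.1|⁻¹ * cuspV a (1 + 1 / 2) p := by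
      rw [inv_mul_cuspV hp]; congr 1; norm_num
    rw [abs_mul, e]
    calc _ ≤ (C2 * |p.1|⁻¹) * (C * cuspV a (1 + 1 / 2) p) := by
          gcongr
          exact (hC p hp hp1).2.1
      _ = _ := by ring
  -- generic domination
  have dom : ∀ (h k : ℝ × ℝ → ℝ) (K : ℝ), 0 ≤ K →
      (∀ p : ℝ × ℝ, p.1 ≠ 0 → |p.1| < 1 → |h p| ≤ K * cuspV a (2 + 1 / 2) p) →
      (∀ p, |k p| ≤ P) → (∀ p, p ∉ cStrip → k p = 0) →
      ∀ᵐ p : ℝ × ℝ, ‖h p * k p‖ ≤ cStrip.indicator (fun p => K * P * cuspV a (2 + 1 / 2) p) p := by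
    intro h k K hK hh hk hk0
    filter_upwards [ae_fst_ne] with p hp
    by_cases hs : p ∈ cStrip
    · rw [indicator_of_mem hs, Real.norm_eq_abs, abs_mul]
      have := cuspV_nonneg a (2 + 1 / 2) p
      calc _ ≤ (K * cuspV a (2 + 1 / 2) p) * P := by
            gcongr
            · exact hh p hp hs
            · exact hk p
        _ = _ := by ring
    · rw [indicator_of_notMem hs, hk0 p hs]; simp
  have limE : ∀ p : ℝ × ℝ, p.1 ≠ 0 → ∀ c : ℝ,
      Tendsto (fun n => cEta χ n p.1 * c) atTop (𝓝 c) := by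
    intro p hp c
    apply tendsto_const_nhds.congr'
    filter_upwards [eventually_notMem hp] with n hn
    rw [cEta, hz _ hn]; ring
  have bEmul : ∀ (h : ℝ × ℝ → ℝ) (K : ℝ),
      (∀ p : ℝ × ℝ, p.1 ≠ 0 → |p.1| < 1 → |h p| ≤ K * cuspV a (2 + 1 / 2) p) →
      ∀ n, (∀ p : ℝ × ℝ, p.1 ≠ 0 → |p.1| < 1 →
        |cEta χ n p.1 * h p| ≤ K * cuspV a (2 + 1 / 2) p) := by
    intro h K hh n p hp hp1
    rw [abs_mul]
    calc _ ≤ 1 * |h p| := by gcongr; exact bE n p.1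
      _ ≤ _ := by rw [one_mul]; exact hh p hp hp1
  -- limits of left hand sides
  have lim1 : Tendsto (fun n => ∫ p, (cEta χ n p.1 * cUX a χ p) * fderiv ℝ φ p (1, 0)) atTop
      (𝓝 (∫ p, cUX a χ p * fderiv ℝ φ p (1, 0))) := by
    refine tendsto_integral_of_dominated_convergence _ (fun n => ?_) (hHint (C * P))
      (fun n => dom (fun p => cEta χ n p.1 * cUX a χ p) _ C hC0 (bEmul _ _ bX n)
        (fun p => hdb p _ n1) (fun p => hd0 p _)) ?_
    · exact (((hmE n).mul hmX).mul (hmd _)).aestronglyMeasurable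
    · filter_upwards [ae_fst_ne] with p hp
      simpa only [mul_assoc] using limE p hp (cUX a χ p * fderiv ℝ φ p (1, 0))
  have lim2 : Tendsto (fun n => ∫ p, (cEta χ n p.1 * g2 p) * fderiv ℝ φ p (0, 1)) atTop
      (𝓝 (∫ p, g2 p * fderiv ℝ φ p (0, 1))) := by
    refine tendsto_integral_of_dominated_convergence _ (fun n => ?_) (hHint (C * P))
      (fun n => dom (fun p => cEta χ n p.1 * g2 p) _ C hC0 (bEmul _ _ bY n)
        (fun p => hdb p _ n2) (fun p => hd0 p _)) ?_
    · exact (((hmE n).mul hmg).mul (hmd _)).aestronglyMeasurable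
    · filter_upwards [ae_fst_ne] with p hp
      simpa only [mul_assoc] using limE p hp (g2 p * fderiv ℝ φ p (0, 1))
  have lim3 : Tendsto (fun n : ℕ => ∫ p, (cEta χ n p.1 * cF a χ p
        - ((n : ℝ) + 1) * deriv χ ((n + 1) * p.1) * cUX a χ p) * φ p) atTop
      (𝓝 (∫ p, cF a χ p * φ p)) := by
    refine tendsto_integral_of_dominated_convergence _ (fun n => ?_) (hHint ((C + C2 * C) * P))
      (fun n => dom (fun p => cEta χ n p.1 * cF a χ p
        - ((n : ℝ) + 1) * deriv χ ((n + 1) * p.1) * cUX a χ p) _ (C + C2 * C) (by positivity) ?_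
        hφb hφ0) ?_
    · have : Measurable fun p : ℝ × ℝ => deriv χ (((n : ℝ) + 1) * p.1) :=
        (measurable_deriv χ).comp (by fun_prop)
      exact ((((hmE n).mul hmF).sub ((this.const_mul _).mul hmX)).mul hmφ).aestronglyMeasurable
    · intro p hp hp1
      refine (abs_sub _ _).trans ?_
      rw [add_mul C]
      exact add_le_add (bEmul _ _ bF n p hp hp1) (bE' n p hp hp1)
    · filter_upwards [ae_fst_ne] with p hp
      apply tendsto_const_nhds.congr'
      filter_upwards [eventually_notMem hp] with n hn
      rw [cEta, hz _ hn, cutoff_vanish hz _ hn]; ring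
  -- regularity
  have cg2 : ∀ p : ℝ × ℝ, p.1 ≠ 0 → ContDiffAt ℝ 1 (fun p : ℝ × ℝ => (|p.1| ^ m) ^ 2) p := by
    intro p hp
    have h1 : ContDiffAt ℝ 1 (fun p : ℝ × ℝ => (Real.exp (m * Real.log p.1)) ^ 2) p :=
      ((contDiffAt_const.mul ((contDiffAt_fst (𝕜 := ℝ) (n := 1) (p := p)).log hp)).exp).pow 2
    apply h1.congr_of_eventuallyEq
    filter_upwards [continuous_fst.continuousAt.eventually_ne hp] with q hq
    rw [exp_mul_log_eq hq]
  have cX : ∀ p : ℝ × ℝ, p.1 ≠ 0 → ContDiffAt ℝ 1 (cUX a χ) p := fun p hp => contDiffAt_cUX hχ hp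
  have cY : ∀ p : ℝ × ℝ, p.1 ≠ 0 → ContDiffAt ℝ 1 g2 p :=
    fun p hp => (cg2 p hp).mul (contDiffAt_cUY hχ hp)
  have dg2 : ∀ p : ℝ × ℝ, p.1 ≠ 0 → fderiv ℝ g2 p (0, 1)
      = (|p.1| ^ m) ^ 2 * fderiv ℝ (cUY a χ) p (0, 1) := by
    intro p hp
    have hd := (cg2 p hp).differentiableAt (by simp)
    have d2 := fderiv_snd_of hd (hasDerivAt_const p.2 ((|p.1| ^ m) ^ 2))
    simp only [g2]
    rw [fderiv_fun_mul hd ((contDiffAt_cUY hχ hp).differentiableAt (by simp))]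
    simp only [add_apply, smul_apply, smul_eq_mul, d2]
    ring
  have ident : ∀ n : ℕ, (∫ p, (cEta χ n p.1 * cUX a χ p) * fderiv ℝ φ p (1, 0))
      + (∫ p, (cEta χ n p.1 * g2 p) * fderiv ℝ φ p (0, 1))
      = - ∫ p, (cEta χ n p.1 * cF a χ p
        - ((n : ℝ) + 1) * deriv χ ((n + 1) * p.1) * cUX a χ p) * φ p := by
    intro n
    have k1 := contDiff_cEta_mul hχ hone n cX
    have k2 := contDiff_cEta_mul hχ hone n cY
    have int : ∀ (G : ℝ × ℝ → ℝ) (v : ℝ × ℝ), ContDiff ℝ 1 G →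
        Integrable fun p => fderiv ℝ G p v * φ p := by
      intro G v hG
      apply Continuous.integrable_of_hasCompactSupport
      · exact ((hG.continuous_fderiv (by simp)).clm_apply continuous_const).mul hφ.continuous
      · exact hc.mul_left
    rw [ibp_aux k1 hφ hc, ibp_aux k2 hφ hc, ← neg_add, ← integral_add (int _ _ k1) (int _ _ k2)]
    congr 1
    apply integral_congr_ae
    filter_upwards [ae_fst_ne] with p hp
    rw [(fderiv_cEta_mul hχ n ((cX p hp).differentiableAt (by simp))).1,
      (fderiv_cEta_mul hχ n ((cY p hp).differentiableAt (by simp))).2, dg2 p hp,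
      ← cF_eq hχ hp]
    ring
  have L1 := lim1.add lim2
  simp_rw [ident] at L1
  have key := tendsto_nhds_unique L1 lim3.neg
  rw [← key]
  have i1 : Integrable fun p => cUX a χ p * fderiv ℝ φ p (1, 0) :=
    (hHint (C * P)).mono' (hmX.mul (hmd _)).aestronglyMeasurable
      (dom _ _ C hC0 bX (fun p => hdb p _ n1) (fun p => hd0 p _))
  have i2 : Integrable fun p => g2 p * fderiv ℝ φ p (0, 1) :=
    (hHint (C * P)).mono' (hmg.mul (hmd _)).aestronglyMeasurable
      (dom _ _ C hC0 bY (fun p => hdb p _ n2) (fun p => hd0 p _))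
  exact integral_add i1 i2

lemma cuspV_rpow {a β q : ℝ} (hq : 0 < q) (p : ℝ × ℝ) :
    cuspV a β p ^ q = cuspV a (q * β) p := by
  unfold cuspV
  split_ifs
  · rw [← Real.rpow_mul (abs_nonneg _)]; congr 1; ring
  · exact Real.zero_rpow hq.ne'

lemma lintegral_lt_of_bound {a β K : ℝ} (ha : 0 < a) (hβ : β < a + 1)
    {h : ℝ × ℝ → ℝ} {B : Set (ℝ × ℝ)} (hB : B ⊆ cStrip) (hBm : MeasurableSet B)
    (hh : ∀ p : ℝ × ℝ, p.1 ≠ 0 → |p.1| < 1 → h p ≤ K * cuspV a β p) :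
    ∫⁻ p in B, ENNReal.ofReal (h p) < ⊤ := by
  have hi := ((integrable_indicator_iff measurableSet_cStrip).1 (integrable_maj ha hβ K)).mono_set hB
  refine lt_of_le_of_lt (lintegral_mono_ae ?_) hi.lintegral_lt_top
  filter_upwards [ae_restrict_mem hBm, ae_restrict_of_ae ae_fst_ne] with p hp hp0
  exact ENNReal.ofReal_le_ofReal (hh p hp0 (hB hp))

lemma cutoff_inner {χ : ℝ → ℝ} (hone : ∀ s ∈ Set.Icc (-1 : ℝ) 1, χ s = 1) :
    ∀ s ∈ Ioo (-1 : ℝ) 1, χ s = 1 ∧ deriv χ s = 0 ∧ deriv (deriv χ) s = 0 := by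
  have h1 : ∀ s ∈ Ioo (-1 : ℝ) 1, deriv χ s = 0 := by
    intro s hs
    have : χ =ᶠ[𝓝 s] fun _ => 1 := by
      filter_upwards [isOpen_Ioo.mem_nhds hs] with t ht using hone t (Ioo_subset_Icc_self ht)
    rw [this.deriv_eq]; simp
  intro s hs
  refine ⟨hone s (Ioo_subset_Icc_self hs), h1 s hs, ?_⟩
  have : deriv χ =ᶠ[𝓝 s] fun _ => 0 := by
    filter_upwards [isOpen_Ioo.mem_nhds hs] with t ht using h1 t ht
  rw [this.deriv_eq]; simp

lemma cuspT_spec {a r : ℝ} (ha : 1 ≤ a) (hr : r ≤ 1) {p : ℝ × ℝ} (hp : p ∈ cuspT a r) :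
    0 < p.1 ∧ p.1 < r ∧ 0 < p.2 ∧ p.2 < r ∧ cS a p ∈ Ioo (-1 : ℝ) 1 := by
  obtain ⟨⟨h1, h2⟩, h3, h4⟩ := hp
  have ha0 : 0 < a := by linarith
  have hpos : 0 < p.1 ^ a := Real.rpow_pos_of_pos h1 a
  refine ⟨h1, h2, h3, ?_, ?_⟩
  · have : p.1 ^ a ≤ p.1 := by
      simpa using Real.rpow_le_rpow_of_exponent_ge h1 (h2.le.trans hr) ha
    have : p.1 ^ a / a ≤ p.1 ^ a := div_le_self hpos.le ha
    linarith
  · have hS : cS a p = a * p.2 / p.1 ^ a := by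
      rw [cS, ← neg_mul, exp_mul_log_eq h1.ne', abs_of_pos h1, Real.rpow_neg h1.le, div_eq_mul_inv]
    have h5 : 0 < cS a p := by rw [hS]; positivity
    refine ⟨by linarith, ?_⟩
    rw [hS, div_lt_one hpos]
    rw [lt_div_iff₀ ha0] at h4
    linarith

lemma cuspT_nonempty {a r : ℝ} (ha : 0 < a) (hr : 0 < r) : (cuspT a r).Nonempty := by
  have h : 0 < (r / 2) ^ a / a := by positivity
  exact ⟨(r / 2, (r / 2) ^ a / a / 2), ⟨by simpa using hr, by simpa using hr⟩,
    by simpa using h, by simpa using h⟩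

/-- **finitely degenerate counterexample.** Fix `m ≥ 1`,
`ψ(x) = x^{m+1}/(m+1)`, `g(x) = x^m`, a smooth cutoff `χ`, and on a sufficiently small ball
`B = B(0,ρ) ⊂ ℝ²` let `u(x,y) = χ(y/ψ(|x|)) ln(1/|x|)` (with `u = 0` on `x = 0`),
`A = diag(1, g(|x|)²)` and `f = ∇·A∇u` (computed classically for `x ≠ 0`). Then:
(i) `u ∈ W_A^{1,2}(B)`; (ii) `u` is essentially unbounded near the origin;
(iii) `u` is a weak solution of `∇·A∇u = f` in `B`; (iv) for `q ≥ 1`,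
`f ∈ L^q(B)` iff `q < (m+2)/2`. -/
theorem statement15 (m : ℝ) (hm : 1 ≤ m)
    (χ : ℝ → ℝ) (hχsmooth : ContDiff ℝ (⊤ : ℕ∞) χ) (hχ01 : ∀ s, 0 ≤ χ s ∧ χ s ≤ 1)
    (hχone : ∀ s ∈ Set.Icc (-1 : ℝ) 1, χ s = 1)
    (hχzero : ∀ s, s ∉ Set.Icc (-2 : ℝ) 2 → χ s = 0)
    (ψ g : ℝ → ℝ)
    (hψ : ∀ x : ℝ, ψ x = x ^ (m + 1) / (m + 1))
    (hg : ∀ x : ℝ, g x = x ^ m)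
    (u ux uy f : ℝ × ℝ → ℝ)
    (hu : ∀ p : ℝ × ℝ, u p =
      if p.1 = 0 then 0 else χ (p.2 / ψ |p.1|) * Real.log (1 / |p.1|))
    (hux : ∀ p : ℝ × ℝ, ux p = fderiv ℝ u p (1, 0))
    (huy : ∀ p : ℝ × ℝ, uy p = fderiv ℝ u p (0, 1))
    (hf : ∀ p : ℝ × ℝ, f p = if p.1 = 0 then 0 else
      fderiv ℝ ux p (1, 0) + (g |p.1|) ^ 2 * fderiv ℝ uy p (0, 1)) :
    ∃ ρ₀ > (0 : ℝ), ∀ ρ : ℝ, 0 < ρ → ρ ≤ ρ₀ →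
      (letI B : Set (ℝ × ℝ) := {p | p.1 ^ 2 + p.2 ^ 2 < ρ ^ 2}
      -- (i) `∫_B (u_x² + g²u_y²) < ∞` and `u ∈ L²(B)`, i.e. `u ∈ W_A^{1,2}(B)`
      (∫⁻ p in B, ENNReal.ofReal ((ux p) ^ 2 + (g |p.1|) ^ 2 * (uy p) ^ 2)) < ⊤ ∧
      (∫⁻ p in B, ENNReal.ofReal ((u p) ^ 2)) < ⊤ ∧
      -- (ii) `u` is essentially unbounded on every neighborhood of the origin
      (∀ U ∈ 𝓝 ((0, 0) : ℝ × ℝ), eLpNorm u ⊤ (volume.restrict U) = ⊤) ∧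
      -- (iii) `u` is a weak solution of `∇·A∇u = f` in `B`
      (∀ φ : ℝ × ℝ → ℝ, (∃ L, LipschitzWith L φ) → HasCompactSupport φ → tsupport φ ⊆ B →
        (∫ p in B, (ux p * fderiv ℝ φ p (1, 0) +
            (g |p.1|) ^ 2 * uy p * fderiv ℝ φ p (0, 1))) = - ∫ p in B, f p * φ p) ∧
      -- (iv) for `q ≥ 1`, `f ∈ L^q(B)` iff `q < (m+2)/2`
      (∀ q : ℝ, 1 ≤ q →
        ((∫⁻ p in B, ENNReal.ofReal |f p| ^ q) < ⊤ ↔ q < (m + 2) / 2))) := by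
  set a := m + 1 with ha_def
  have ha1 : 1 ≤ a := by linarith
  have ha : 0 < a := by linarith
  have eu : ∀ p : ℝ × ℝ, p.1 ≠ 0 → u p = cU a χ p := by
    intro p hp
    rw [hu, if_neg hp, cU, cS, hψ, ← neg_mul, exp_mul_log_eq hp, Real.rpow_neg (abs_nonneg _),
      one_div, Real.log_inv, Real.log_abs]
    congr 2
    rw [div_div_eq_mul_div, div_eq_mul_inv, mul_comm a]
  have ne_ev : ∀ p : ℝ × ℝ, p.1 ≠ 0 → ∀ᶠ q : ℝ × ℝ in 𝓝 p, q.1 ≠ 0 := fun p hp =>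
    continuous_fst.continuousAt.eventually_ne hp
  have eux : ∀ p : ℝ × ℝ, p.1 ≠ 0 → ux p = cUX a χ p := by
    intro p hp
    have : u =ᶠ[𝓝 p] cU a χ := (ne_ev p hp).mono eu
    rw [hux, this.fderiv_eq, fderiv_cU_fst hχsmooth hp]
  have euy : ∀ p : ℝ × ℝ, p.1 ≠ 0 → uy p = cUY a χ p := by
    intro p hp
    have : u =ᶠ[𝓝 p] cU a χ := (ne_ev p hp).mono eu
    rw [huy, this.fderiv_eq, fderiv_cU_snd hχsmooth hp]
  have ef : ∀ p : ℝ × ℝ, p.1 ≠ 0 → f p = cF a χ p := by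
    intro p hp
    have h1 : ux =ᶠ[𝓝 p] cUX a χ := (ne_ev p hp).mono eux
    have h2 : uy =ᶠ[𝓝 p] cUY a χ := (ne_ev p hp).mono euy
    rw [hf, if_neg hp, h1.fderiv_eq, h2.fderiv_eq, hg, cF_eq hχsmooth hp]
  refine ⟨1, one_pos, fun ρ hρ hρ1 => ?_⟩
  set B : Set (ℝ × ℝ) := {p | p.1 ^ 2 + p.2 ^ 2 < ρ ^ 2} with hB
  have hBo : IsOpen B := isOpen_lt
    ((continuous_fst.pow 2).add (continuous_snd.pow 2)) continuous_const
  have hBm := hBo.measurableSet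
  have hBs : B ⊆ cStrip := by
    intro p hp
    have hp' : p.1 ^ 2 + p.2 ^ 2 < ρ ^ 2 := hp
    have : p.1 ^ 2 < 1 := by nlinarith [sq_nonneg p.2]
    exact (sq_lt_one_iff_abs_lt_one _).1 this
  obtain ⟨C, hC0, hC⟩ := cusp_bounds hm hχsmooth hχzero (δ := 1 / 4) (by norm_num)
  refine ⟨?_, ?_, ?_, ?_, ?_⟩
  · refine lintegral_lt_of_bound (K := 2 * C ^ 2) (β := 2 * (1 + 1 / 4)) ha (by linarith) hBs hBm ?_
    intro p hp hp1
    obtain ⟨-, h1, h2, -⟩ := hC p hp hp1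
    rw [eux p hp, euy p hp, hg, ← cuspV_rpow two_pos, Real.rpow_two, ← mul_pow]
    have h1' := sq_le_sq' (by linarith [neg_abs_le (cUX a χ p)]) ((le_abs_self _).trans h1)
    have h2' := sq_le_sq' (by linarith [neg_abs_le (|p.1| ^ m * cUY a χ p)])
      ((le_abs_self _).trans h2)
    nlinarith
  · refine lintegral_lt_of_bound (K := C ^ 2) (β := 2 * (1 / 4)) ha (by linarith) hBs hBm ?_
    intro p hp hp1
    obtain ⟨h1, -⟩ := hC p hp hp1
    rw [eu p hp, ← cuspV_rpow two_pos, Real.rpow_two, ← mul_pow]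
    exact sq_le_sq' (by linarith [neg_abs_le (cU a χ p)]) ((le_abs_self _).trans h1)
  · intro U hU
    by_contra hne
    obtain ⟨ε, hε, hεU⟩ := Metric.mem_nhds_iff.1 hU
    set M := (eLpNorm u ⊤ (volume.restrict U)).toReal with hM
    set r := min (min ε 1) (Real.exp (-M)) with hr
    have hr0 : 0 < r := by positivity
    have hr1 : r ≤ 1 := (min_le_left _ _).trans (min_le_right _ _)
    have hrε : r ≤ ε := (min_le_left _ _).trans (min_le_left _ _)
    have hrM : r ≤ Real.exp (-M) := min_le_right _ _
    have hTU : cuspT a r ⊆ U := by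
      intro p hp
      obtain ⟨h1, h2, h3, h4, -⟩ := cuspT_spec ha1 hr1 hp
      apply hεU
      rw [Metric.mem_ball, Prod.dist_eq, max_lt_iff, Real.dist_eq, Real.dist_eq]
      simp only [sub_zero, abs_of_pos h1, abs_of_pos h3]
      exact ⟨by linarith, by linarith⟩
    have hTo := isOpen_cuspT ha r
    have hae : ∀ᵐ p ∂(volume.restrict (cuspT a r)), ‖u p‖ₑ ≤ eLpNorm u ⊤ (volume.restrict U) := by
      have : ∀ᵐ p ∂(volume.restrict U), ‖u p‖ₑ ≤ eLpNorm u ⊤ (volume.restrict U) := by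
        rw [eLpNorm_exponent_top]
        exact ae_le_eLpNormEssSup
      exact ae_mono (Measure.restrict_mono hTU le_rfl) this
    have hF : ∀ᵐ p ∂(volume.restrict (cuspT a r)), False := by
      filter_upwards [hae, ae_restrict_mem hTo.measurableSet] with p hp hpT
      obtain ⟨h1, h2, h3, h4, h5⟩ := cuspT_spec ha1 hr1 hpT
      have hup : u p = - Real.log p.1 := by
        rw [eu p h1.ne', cU, (cutoff_inner hχone _ h5).1, one_mul]
      have hlog : Real.log p.1 < -M := by
        rw [Real.log_lt_iff_lt_exp h1]; linarith
      have h6 : M < ‖u p‖ := by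
        rw [hup, Real.norm_eq_abs]
        exact lt_of_lt_of_le (by linarith) (le_abs_self _)
      have h7 := ENNReal.toReal_mono hne hp
      rw [toReal_enorm] at h7
      linarith
    rw [eventually_false_iff_eq_bot, ae_eq_bot, Measure.restrict_eq_zero] at hF
    exact (hTo.measure_pos volume (cuspT_nonempty ha hr0)).ne' hF
  · rintro φ ⟨L, hL⟩ hc hsub
    have hw := cusp_weak hm hχsmooth hχ01 hχone hχzero hL hc (hsub.trans hBs)
    have e1 : ∫ p in B, (ux p * fderiv ℝ φ p (1, 0) + (g |p.1|) ^ 2 * uy p * fderiv ℝ φ p (0, 1))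
        = ∫ p, (ux p * fderiv ℝ φ p (1, 0) + (g |p.1|) ^ 2 * uy p * fderiv ℝ φ p (0, 1)) := by
      apply setIntegral_eq_integral_of_forall_compl_eq_zero
      intro p hp
      have : fderiv ℝ φ p = 0 := by
        by_contra h
        exact hp (hsub (support_fderiv_subset ℝ h))
      simp [this]
    have e2 : ∫ p in B, f p * φ p = ∫ p, f p * φ p := by
      apply setIntegral_eq_integral_of_forall_compl_eq_zero
      intro p hp
      rw [image_eq_zero_of_notMem_tsupport (fun h => hp (hsub h)), mul_zero]
    rw [e1, e2]
    refine Eq.trans ?_ (hw.trans (congrArg Neg.neg ?_))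
    · apply integral_congr_ae
      filter_upwards [ae_fst_ne] with p hp
      rw [eux p hp, euy p hp, hg]
    · apply integral_congr_ae
      filter_upwards [ae_fst_ne] with p hp
      rw [ef p hp]
  · intro q hq
    have hq0 : 0 < q := by linarith
    have eq1 : ∀ p, ENNReal.ofReal |f p| ^ q = ENNReal.ofReal (|f p| ^ q) := fun p =>
      ENNReal.ofReal_rpow_of_nonneg (abs_nonneg _) hq0.le
    simp_rw [eq1]
    constructor
    · intro hfin
      by_contra hlt
      push Not at hlt
      set r := ρ / 2 with hr
      have hr0 : 0 < r := by positivity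
      have hr1 : r ≤ 1 := by linarith
      have hTB : cuspT a r ⊆ B := by
        intro p hp
        obtain ⟨h1, h2, h3, h4, -⟩ := cuspT_spec ha1 hr1 hp
        have : p.1 ^ 2 + p.2 ^ 2 < ρ ^ 2 := by
          have i1 : p.1 ^ 2 < r ^ 2 := by gcongr
          have i2 : p.2 ^ 2 < r ^ 2 := by gcongr
          nlinarith
        exact this
      have htop := lintegral_cuspT (s := -(2 * q)) ha hr0 (by linarith)
      have : ∫⁻ p in cuspT a r, ENNReal.ofReal (|f p| ^ q)
          = ∫⁻ p in cuspT a r, ENNReal.ofReal (p.1 ^ (-(2 * q))) := by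
        apply setLIntegral_congr_fun (isOpen_cuspT ha r).measurableSet
        intro p hp
        obtain ⟨h1, h2, h3, h4, h5⟩ := cuspT_spec ha1 hr1 hp
        obtain ⟨c0, c1, c2⟩ := cutoff_inner hχone _ h5
        have : f p = p.1 ^ (-2 : ℝ) := by
          rw [ef p h1.ne', cF, c0, c1, c2, Real.rpow_neg h1.le, Real.rpow_two]; ring
        simp only
        rw [this, abs_of_pos (Real.rpow_pos_of_pos h1 _), ← Real.rpow_mul h1.le]
        congr 2; ring
      have hle := lintegral_mono_set (μ := volume) (f := fun p => ENNReal.ofReal (|f p| ^ q)) hTB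
      rw [this, htop] at hle
      exact absurd hfin (not_lt.2 hle)
    · intro hlt
      set δ := ((m + 2) / q - 2) / 2 with hδ
      have hδ0 : 0 < δ := by
        have : 2 < (m + 2) / q := by rw [lt_div_iff₀ hq0]; linarith
        rw [hδ]; linarith
      have hβ : q * (2 + δ) < a + 1 := by
        have : q * (2 + δ) = q + (m + 2) / 2 := by rw [hδ]; field_simp; ring
        rw [this]; linarith
      obtain ⟨C', hC0', hC'⟩ := cusp_bounds hm hχsmooth hχzero hδ0
      refine lintegral_lt_of_bound (K := C' ^ q) ha hβ hBs hBm ?_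
      intro p hp hp1
      rw [ef p hp, ← cuspV_rpow hq0, ← Real.mul_rpow hC0' (cuspV_nonneg _ _ _)]
      exact Real.rpow_le_rpow (abs_nonneg _) (hC' p hp hp1).2.2.2 hq0.le


end
end
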